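/- Let w be a Grassmannian permutation with ℓ(w) ≥ 1 and let B ∈ BPD(w). Then jdt(γ(B)) = γ(∇B); that is, a jeu de taquin slide on Weigandt's tableau of B yields Weigandt's tableau of ∇B. -/

import Mathlib

/- Common definitions for formalizing "Lenart's bijection via bumpless pipe dreams"
   (Gregory–Hamaker). -/

namespace BPDPaper

/-! ### Permutations of the positive integers -/

/-- We model permutations of the positive integers as permutations of `ℕ`
(fixing `0`, with finite support). -/
abbrev Perm' := Equiv.Perm ℕ

/-- The simple transposition `s_a = t_{a,a+1}`. -/
def sT (a : ℕ) : Perm' := Equiv.swap a (a + 1)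

/-- The transposition `t_{ij}`. -/
def tT (i j : ℕ) : Perm' := Equiv.swap i j

/-- The product `s_{a_1} ⋯ s_{a_p}` of a word. -/
def wordProd (l : List ℕ) : Perm' := (l.map sT).prod

/-- `l` is a word for `w` (in the letters `s_1, s_2, …`). -/
def IsWord (w : Perm') (l : List ℕ) : Prop := (∀ x ∈ l, 1 ≤ x) ∧ wordProd l = w

/-- The Coxeter length `ℓ(w)`: the minimal length of a word for `w`. -/
noncomputable def plen (w : Perm') : ℕ :=
  sInf {m | ∃ l : List ℕ, IsWord w l ∧ l.length = m}

/-- `l` is a reduced word for `w`. -/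
def IsReducedWord (w : Perm') (l : List ℕ) : Prop := IsWord w l ∧ l.length = plen w

/-- A permutation of the positive integers: fixes `0` and all but finitely many points. -/
def IsPerm (w : Perm') : Prop := w 0 = 0 ∧ {k | w k ≠ k}.Finite

/-- `k` is a descent of `w`. -/
def Descent (w : Perm') (k : ℕ) : Prop := 1 ≤ k ∧ w (k + 1) < w k

/-- `w` is Grassmannian: at most one descent. -/
def Grassmannian (w : Perm') : Prop := IsPerm w ∧ Set.Subsingleton {k | Descent w k}

/-- `w` is vexillary: no indices `i < j < k < l` with `w j < w i < w l < w k`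
(pattern 2143 avoidance). -/
def Vexillary (w : Perm') : Prop := IsPerm w ∧
  ¬ ∃ i j k l : ℕ, 1 ≤ i ∧ i < j ∧ j < k ∧ k < l ∧ w j < w i ∧ w i < w l ∧ w l < w k

/-- The code `c_i(w) = #{j > i : w j < w i}`. -/
noncomputable def codeOf (w : Perm') (i : ℕ) : ℕ := Nat.card {j : ℕ | i < j ∧ w j < w i}

/-- Insert into a weakly decreasing list, keeping it weakly decreasing. -/
def insDesc (x : ℕ) : List ℕ → List ℕ
  | [] => [x]
  | y :: ys => if y < x then x :: y :: ys else y :: insDesc x ys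

/-- Sort a list into weakly decreasing order. -/
def sortDesc (l : List ℕ) : List ℕ := l.foldr insDesc []

/-- The shape `λ(w)`: the code `(c_1(w), …, c_n(w))` sorted decreasingly, zeros dropped
(`n` is any bound on the support of `w`). -/
noncomputable def shapeOf (w : Perm') (n : ℕ) : List ℕ :=
  (sortDesc ((List.range' 1 n).map (codeOf w))).filter (fun x => decide (0 < x))

/-- The Rothe diagram `D_w = {(i, w j) : i < j, w j < w i}` (matrix coordinates). -/
def RotheDiagram (w : Perm') : Set (ℕ × ℕ) :=
  {p | 1 ≤ p.1 ∧ ∃ j, p.1 < j ∧ w j < w p.1 ∧ p.2 = w j}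

/-- `φ_i`: the row index of the southeast-most box of `D_w` on the diagonal through
`(i, λ_i)`. -/
noncomputable def flagEntry (w : Perm') (i li : ℕ) : ℕ :=
  sSup {r : ℕ | ∃ c : ℕ, (r, c) ∈ RotheDiagram w ∧ (c : ℤ) - (r : ℤ) = (li : ℤ) - (i : ℤ)}

/-- The flag `φ(w) = (φ_1, …, φ_m)` of a vexillary permutation. -/
noncomputable def flagOf (w : Perm') (n : ℕ) : List ℕ :=
  (List.range (shapeOf w n).length).map (fun k => flagEntry w (k + 1) ((shapeOf w n).getD k 0))

/-- `ρ(w)_i`: the `i`-th row of the smallest partition whose Young diagram contains `D_w`. -/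
noncomputable def rhoRow (w : Perm') (i : ℕ) : ℕ :=
  sSup {c : ℕ | ∃ r : ℕ, i ≤ r ∧ (r, c) ∈ RotheDiagram w}

/-! ### Tableaux (lists of rows), flagged SSYT, jeu de taquin -/

/-- Semistandard Young tableau of partition shape, presented as a list of rows. -/
def IsSSYT (T : List (List ℕ)) : Prop :=
  (∀ row ∈ T, row ≠ []) ∧
  List.Chain' (fun r1 r2 : List ℕ => r2.length ≤ r1.length) T ∧
  (∀ row ∈ T, List.Chain' (· ≤ ·) row) ∧
  (∀ i j : ℕ, i + 1 < T.length → j < (T.getD (i + 1) []).length →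
    (T.getD i []).getD j 0 < (T.getD (i + 1) []).getD j 0)

/-- `φ`-flagged semistandard Young tableaux of shape `λ`: the last entry of row `i`
is at most `φ_i`. -/
def IsFlaggedSSYT (lam phi : List ℕ) (T : List (List ℕ)) : Prop :=
  IsSSYT T ∧ T.map List.length = lam ∧
  ∀ i : ℕ, i < T.length → (T.getD i []).getLastD 0 ≤ phi.getD i 0

/-- Semistandard Young tableaux with all entries at most `k` (`SSYT_k`). -/
def IsSSYTBounded (k : ℕ) (T : List (List ℕ)) : Prop :=
  IsSSYT T ∧ ∀ row ∈ T, ∀ x ∈ row, x ≤ k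

/-- Set an entry of a tableau. -/
def setEntry (T : List (List ℕ)) (r c x : ℕ) : List (List ℕ) :=
  T.set r ((T.getD r []).set c x)

/-- One jeu de taquin slide with the empty tile at `(r, c)` (0-indexed):
swap the empty tile with the smaller of the entries to its right and below
(ties move down; missing boxes are `∞`); when both are missing, delete the cell. -/
def jdtAux : ℕ → List (List ℕ) → ℕ → ℕ → List (List ℕ)
  | 0, T, _, _ => T
  | fuel + 1, T, r, c =>
    match (T.getD r [])[c + 1]?, (T.getD (r + 1) [])[c]? with
    | none, none => (T.set r ((T.getD r []).take c)).filter (fun row => !row.isEmpty)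
    | some x, none => jdtAux fuel (setEntry T r c x) r (c + 1)
    | none, some y => jdtAux fuel (setEntry T r c y) (r + 1) c
    | some x, some y =>
      if x < y then jdtAux fuel (setEntry T r c x) r (c + 1)
      else jdtAux fuel (setEntry T r c y) (r + 1) c

/-- `jdt(T)`: remove the top-left box of `T` and rectify by jeu de taquin. -/
def jdt (T : List (List ℕ)) : List (List ℕ) :=
  jdtAux ((T.map List.length).sum + 1) T 0 0

/-! ### Edelman–Greene column insertion and the recording tableau -/

/-- Edelman–Greene insertion of `x` into one increasing column `C`.
Returns the new column together with `none` (if `x` was appended, creating a new box)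
or `some y` (where `y` is to be inserted into the next column). -/
def colIns (x : ℕ) (C : List ℕ) : List ℕ × Option ℕ :=
  if C.all (fun c => decide (c < x)) then (C ++ [x], none)
  else if x ∈ C ∧ (x + 1) ∈ C then (C, some (x + 1))
  else
    match C.find? (fun c => decide (x < c)) with
    | some ck => (C.map (fun c => if c = ck then x else c), some ck)
    | none => (C, none)

/-- Edelman–Greene insertion of `x` into a tableau presented as a list of columns.
Returns the new columns and the (0-indexed) column containing the new box. -/
def egInsert : List (List ℕ) → ℕ → (List (List ℕ)) × ℕ
  | [], x => ([[x]], 0)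
  | C :: rest, x =>
    match colIns x C with
    | (C', none) => (C' :: rest, 0)
    | (C', some y) =>
      let res := egInsert rest y
      (C' :: res.1, res.2 + 1)

/-- One step of the Edelman–Greene algorithm on the pair (insertion, recording) tableau:
insert `ra.2` into `P` and record `ra.1` in the new box of `Q`. -/
def egStep (PQ : (List (List ℕ)) × (List (List ℕ))) (ra : ℕ × ℕ) :
    (List (List ℕ)) × (List (List ℕ)) :=
  let res := egInsert PQ.1 ra.2
  let Q := PQ.2
  let Q' := if res.2 < Q.length then Q.set res.2 (Q.getD res.2 [] ++ [ra.1]) else Q ++ [[ra.1]]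
  (res.1, Q')

/-- A biword `(r_1,…,r_l ; a_1,…,a_l)`. -/
structure Biword where
  top : List ℕ
  bot : List ℕ

/-- The (insertion, recording) column tableaux of a biword under Edelman–Greene insertion. -/
def egPQ (P : Biword) : (List (List ℕ)) × (List (List ℕ)) :=
  (P.top.zip P.bot).foldl egStep ([], [])

/-- Convert a tableau presented as a list of columns into a list of rows. -/
def colsToRows (cols : List (List ℕ)) : List (List ℕ) :=
  (List.range ((cols.map List.length).foldr max 0)).map
    (fun i => cols.filterMap (fun col => col[i]?))

/-- The Edelman–Greene recording tableau `Q̃` of a biword (as a list of rows). -/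
def Qtilde (P : Biword) : List (List ℕ) := colsToRows (egPQ P).2

/-- The Edelman–Greene insertion tableau `P̃` of a biword (as a list of rows). -/
def Ptilde (P : Biword) : List (List ℕ) := colsToRows (egPQ P).1

/-- `(r ; a)` is a reduced compatible sequence for `w`: `a` is a reduced word for `w`,
`r` is weakly increasing, `r_i ≤ a_i`, and `r_i < r_{i+1}` whenever `a_i < a_{i+1}`.
Membership in `PD(w)`. -/
def IsCompatible (w : Perm') (P : Biword) : Prop :=
  IsReducedWord w P.bot ∧
  List.Chain' (· ≤ ·) P.top ∧
  List.Forall₂ (· ≤ ·) P.top P.bot ∧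
  (∀ m : ℕ, m + 1 < P.bot.length →
    P.bot.getD m 0 < P.bot.getD (m + 1) 0 → P.top.getD m 0 < P.top.getD (m + 1) 0)

/-! ### Bumpless pipe dreams -/

/-- The tiles: blank, vertical, horizontal, ⌐-elbow (S–E, "r"), ⌟-elbow (W–N, "j"),
crossing, and the bump tile (for almost bumpless pipe dreams). -/
inductive Tile
  | blank | vert | horiz | se | nw | cross | bump
deriving DecidableEq

/-- A square grid of tiles; rows and columns are 1-indexed, rows increase downward. -/
structure Grid where
  n : ℕ
  tile : ℕ → ℕ → Tile

inductive Dir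
  | north | east
deriving DecidableEq

def hasN : Tile → Bool
  | .vert => true | .nw => true | .cross => true | .bump => true | _ => false
def hasS : Tile → Bool
  | .vert => true | .se => true | .cross => true | .bump => true | _ => false
def hasE : Tile → Bool
  | .horiz => true | .se => true | .cross => true | .bump => true | _ => false
def hasW : Tile → Bool
  | .horiz => true | .nw => true | .cross => true | .bump => true | _ => false

/-- The outgoing direction of a pipe through a tile, given the incoming heading
(`north` = entered through the south edge, `east` = entered through the west edge). -/
def outDir : Tile → Dir → Option Dir
  | .vert, .north => some .north
  | .cross, .north => some .north
  | .se, .north => some .east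
  | .bump, .north => some .east
  | .horiz, .east => some .east
  | .cross, .east => some .east
  | .nw, .east => some .north
  | .bump, .east => some .north
  | _, _ => none

/-- Trace a pipe; returns the row in which it exits through the east edge of the grid. -/
def traceAux (g : Grid) : ℕ → ℕ → ℕ → Dir → Option ℕ
  | 0, _, _, _ => none
  | fuel + 1, x, y, d =>
    match outDir (g.tile x y) d with
    | none => none
    | some Dir.north => if x ≤ 1 then none else traceAux g fuel (x - 1) y Dir.north
    | some Dir.east => if g.n ≤ y then some x else traceAux g fuel x (y + 1) Dir.east

/-- The exit row of the pipe entering at the bottom of column `c`. -/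
def exitRow (g : Grid) (c : ℕ) : Option ℕ := traceAux g (2 * g.n + 2) g.n c Dir.north

/-- The list of states `(row, column, heading)` visited by a pipe. -/
def pathAux (g : Grid) : ℕ → ℕ → ℕ → Dir → List (ℕ × ℕ × Dir)
  | 0, _, _, _ => []
  | fuel + 1, x, y, d =>
    (x, y, d) ::
      (match outDir (g.tile x y) d with
       | none => []
       | some Dir.north => if x ≤ 1 then [] else pathAux g fuel (x - 1) y Dir.north
       | some Dir.east => if g.n ≤ y then [] else pathAux g fuel x (y + 1) Dir.east)

/-- The path of the pipe entering at the bottom of column `c`. -/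
def pipePath (g : Grid) (c : ℕ) : List (ℕ × ℕ × Dir) := pathAux g (2 * g.n + 2) g.n c Dir.north

/-- Pipe `c` passes through position `z`. -/
def passes (g : Grid) (c : ℕ) (z : ℕ × ℕ) : Prop :=
  ∃ d : Dir, (z.1, z.2, d) ∈ pipePath g c

def InGrid (g : Grid) (i j : ℕ) : Prop := 1 ≤ i ∧ i ≤ g.n ∧ 1 ≤ j ∧ j ≤ g.n

/-- A (reduced) bumpless pipe dream: tiles match along edges; pipes enter along the
bottom and exit along the right; no bump tiles; no two pipes cross more than once.
(Tiles outside the grid are normalized to `horiz`.) -/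
def IsBPD (g : Grid) : Prop :=
  1 ≤ g.n ∧
  (∀ i j, ¬ InGrid g i j → g.tile i j = Tile.horiz) ∧
  (∀ i j, InGrid g i j → g.tile i j ≠ Tile.bump) ∧
  (∀ i j, 1 ≤ i → i < g.n → 1 ≤ j → j ≤ g.n → hasS (g.tile i j) = hasN (g.tile (i + 1) j)) ∧
  (∀ i j, 1 ≤ i → i ≤ g.n → 1 ≤ j → j < g.n → hasE (g.tile i j) = hasW (g.tile i (j + 1))) ∧
  (∀ j, 1 ≤ j → j ≤ g.n → hasN (g.tile 1 j) = false) ∧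
  (∀ j, 1 ≤ j → j ≤ g.n → hasS (g.tile g.n j) = true) ∧
  (∀ i, 1 ≤ i → i ≤ g.n → hasW (g.tile i 1) = false) ∧
  (∀ i, 1 ≤ i → i ≤ g.n → hasE (g.tile i g.n) = true) ∧
  (∀ c c', 1 ≤ c → c ≤ g.n → 1 ≤ c' → c' ≤ g.n → c ≠ c' →
    Set.Subsingleton {z : ℕ × ℕ | g.tile z.1 z.2 = Tile.cross ∧ passes g c z ∧ passes g c' z})

/-- `g ∈ BPD(w)`: `g` is a bumpless pipe dream whose permutation is `w`, i.e. the pipe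
entering at the bottom of column `c` exits to the right in row `w⁻¹(c)`. -/
def MemBPD (w : Perm') (g : Grid) : Prop :=
  IsBPD g ∧ w 0 = 0 ∧ (∀ k, g.n < k → w k = k) ∧
  (∀ c, 1 ≤ c → c ≤ g.n → exitRow g c = some (w.symm c))

/-! ### Weigandt's map γ -/

/-- The blank tiles on the diagonal `{(i,j) : j - i = d}`, from northwest to southeast. -/
def blanksOnDiag (g : Grid) (d : ℤ) : List (ℕ × ℕ) :=
  (List.range' 1 g.n).filterMap (fun (i : ℕ) =>
    let jz : ℤ := (i : ℤ) + d
    if 1 ≤ jz ∧ jz ≤ (g.n : ℤ) then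
      (if g.tile i jz.toNat = Tile.blank then some (i, jz.toNat) else none)
    else none)

/-- The number of pipes passing above position `(i,j)`: tiles above it in column `j`
in which a pipe travels eastward. -/
def pipesAbove (g : Grid) (i j : ℕ) : ℕ :=
  ((List.range' 1 g.n).filter (fun x => decide (x < i) && hasE (g.tile x j))).length

/-- Weigandt's map `γ` (for vexillary permutations): fill each blank tile with the number
of pipes above it, slide the filled tiles northwest along their diagonals into the Young
diagram of `lam`, and add `i` to every entry in row `i`. -/
def weigandt (g : Grid) (lam : List ℕ) : List (List ℕ) :=
  (List.range lam.length).map (fun (r0 : ℕ) =>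
    (List.range (lam.getD r0 0)).map (fun (c0 : ℕ) =>
      let r : ℕ := r0 + 1
      let c : ℕ := c0 + 1
      let p := (blanksOnDiag g ((c : ℤ) - (r : ℤ))).getD (min r c - 1) (0, 0)
      pipesAbove g p.1 p.2 + r))

/-! ### The Gao–Huang operator ∇, pop, and the bijection φ -/

/-- Backward tracing: enter tile `(x,y)` through its north edge (`viaN = true`) or its
east edge (`viaN = false`) and follow the pipe backwards; returns the bottom column
at which the pipe enters the grid. -/
def backAux (g : Grid) : ℕ → ℕ → ℕ → Bool → Option ℕ
  | 0, _, _, _ => none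
  | fuel + 1, x, y, viaN =>
    if g.n < x then none
    else if viaN then
      match g.tile x y with
      | .vert | .cross => if x = g.n then some y else backAux g fuel (x + 1) y true
      | .nw | .bump => backAux g fuel x (y - 1) false
      | _ => none
    else
      match g.tile x y with
      | .horiz | .cross => backAux g fuel x (y - 1) false
      | .se | .bump => if x = g.n then some y else backAux g fuel (x + 1) y true
      | _ => none

/-- The label of the pipe passing through `(x,y)` entering from the south. -/
def pipeFromS (g : Grid) (x y : ℕ) : Option ℕ :=
  if x = g.n then some y else backAux g (2 * g.n + 2) (x + 1) y true

/-- Move the mark east to the rightmost blank tile in its contiguous block of blanks. -/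
def slideEast (g : Grid) (i j : ℕ) : ℕ :=
  ((List.range' j (g.n + 1)).takeWhile (fun y => g.tile i y == Tile.blank)).getLastD j

/-- Tile rewrite for the undroop of the pipe `p` (from `(i', j+1)` into `(i, j)`)
performed in one iteration of the Gao–Huang procedure; the `(i', j+1)` case `cross → se`
is the final uncrossing step. -/
def nablaUndroop (T : ℕ → ℕ → Tile) (i i' j : ℕ) : ℕ → ℕ → Tile := fun x y =>
  let t := T x y
  if x = i ∧ y = j then (match t with | Tile.blank => Tile.se | _ => t)
  else if x = i' ∧ y = j then
    (match t with | Tile.se => Tile.vert | Tile.horiz => Tile.nw | _ => t)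
  else if x = i ∧ y = j + 1 then
    (match t with | Tile.se => Tile.horiz | Tile.vert => Tile.nw | _ => t)
  else if x = i' ∧ y = j + 1 then
    (match t with | Tile.nw => Tile.blank | Tile.cross => Tile.se | _ => t)
  else if y = j ∧ i < x ∧ x < i' then
    (match t with | Tile.blank => Tile.vert | Tile.horiz => Tile.cross | _ => t)
  else if y = j + 1 ∧ i < x ∧ x < i' then
    (match t with | Tile.vert => Tile.blank | Tile.cross => Tile.horiz | _ => t)
  else t

/-- Tile rewrite for the droop (from `(k, j)` into `(k', j+1)`) of a pipe `q` having both
a ⌐-turn and a ⌟-turn in column `j`, performed after the undroop of `p`. -/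
def nablaQDroop (T : ℕ → ℕ → Tile) (k k' j : ℕ) : ℕ → ℕ → Tile := fun x y =>
  let t := T x y
  if x = k ∧ y = j then (match t with | Tile.se => Tile.vert | _ => t)
  else if x = k' ∧ y = j then (match t with | Tile.nw => Tile.cross | _ => t)
  else if x = k ∧ y = j + 1 then (match t with | Tile.horiz => Tile.se | _ => t)
  else if x = k' ∧ y = j + 1 then (match t with | Tile.blank => Tile.nw | _ => t)
  else if y = j + 1 ∧ k < x ∧ x < k' then
    (match t with | Tile.blank => Tile.vert | Tile.horiz => Tile.cross | _ => t)
  else t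

/-- The ⌐/⌟ elbow pairs `(k, k')` of pipes in column `j` strictly between rows `i` and `i'`. -/
def qPairs (g : Grid) (i i' j : ℕ) : List (ℕ × ℕ) :=
  (List.range' 1 g.n).filterMap (fun k =>
    if i < k ∧ k < i' ∧ g.tile k j = Tile.se then
      match (List.range' 1 g.n).find?
          (fun k' => decide (k < k' ∧ k' < i' ∧ g.tile k' j = Tile.nw)) with
      | some k' => some (k, k')
      | none => none
    else none)

/-- One iteration of the marked-tile procedure on the rectangle with corners
`(i, j)` and `(i', j+1)`: undroop `p`, then droop the intersecting pipes. -/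
def nablaIter (g : Grid) (i i' j : ℕ) : Grid :=
  ⟨g.n, (qPairs g i i' j).foldl (fun T kk => nablaQDroop T kk.1 kk.2 j)
    (nablaUndroop g.tile i i' j)⟩

/-- The marked-tile loop of the Gao–Huang procedure; returns `(∇B, a)`. -/
def nablaLoop (g : Grid) : ℕ → ℕ × ℕ → Grid × ℕ
  | 0, _ => (g, 0)
  | fuel + 1, (i, j0) =>
    let j := slideEast g i j0
    match pipeFromS g i (j + 1) with
    | none => (g, 0)
    | some p =>
      if p = j + 1 then
        match (List.range' 1 g.n).find? (fun x =>
            decide (i < x) && (g.tile x (j + 1) == Tile.cross) &&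
            (backAux g (2 * g.n + 2) x (j + 1) false == some j)) with
        | some i' => (nablaIter g i i' j, j)
        | none => (g, 0)
      else
        match (List.range' 1 g.n).find? (fun x =>
            decide (i < x) && (g.tile x (j + 1) == Tile.nw)) with
        | some i' => nablaLoop (nablaIter g i i' j) fuel (i', j + 1)
        | none => (g, 0)

/-- The Gao–Huang procedure: returns `(∇B, (r, a))` where `pop(B) = (r, a)`. -/
def nablaPop (g : Grid) : Grid × ℕ × ℕ :=
  match (List.range' 1 g.n).find?
      (fun i => (List.range' 1 g.n).any (fun j => g.tile i j == Tile.blank)) with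
  | none => (g, 0, 0)
  | some r =>
    let j0 := ((List.range' 1 g.n).filter (fun j => g.tile r j == Tile.blank)).getLastD 0
    let res := nablaLoop g (g.n + 1) (r, j0)
    (res.1, r, res.2)

/-- The Gao–Huang operator `∇`. -/
def nabla (g : Grid) : Grid := (nablaPop g).1

/-- `pop(B) = (r, a)`. -/
def pop (g : Grid) : ℕ × ℕ := (nablaPop g).2

/-- The number of crossing tiles of `g` (which equals `ℓ(w)` for `g ∈ BPD(w)`). -/
def crossCount (g : Grid) : ℕ :=
  ((List.range' 1 g.n).map (fun i =>
    ((List.range' 1 g.n).filter (fun j => g.tile i j == Tile.cross)).length)).sum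

def phiAux : ℕ → Grid → List (ℕ × ℕ)
  | 0, _ => []
  | l + 1, g => pop g :: phiAux l (nabla g)

/-- The Gao–Huang bijection `φ : BPD(w) → PD(w)`,
`φ(B) = (r_1,…,r_l ; a_1,…,a_l)` with `(r_i, a_i) = pop(∇^{i-1} B)`. -/
def phi (g : Grid) : Biword :=
  ⟨(phiAux (crossCount g) g).map Prod.fst, (phiAux (crossCount g) g).map Prod.snd⟩

/-! ### Little bumps (relational) -/

/-- The reflection labelling the crossing at position `m` (0-indexed) of the word `a`:
deleting the letter at position `m` from `a` yields a word for `wordProd a * crossingRefl a m`.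
The wires `i` and `j` cross at position `m` iff `crossingRefl a m = t_{ij}`. -/
def crossingRefl (a : List ℕ) (m : ℕ) : Perm' :=
  (wordProd (a.drop (m + 1)))⁻¹ * sT (a.getD m 0) * wordProd (a.drop (m + 1))

/-- `a` is a reduced word (for its own product). -/
def IsReducedSelf (a : List ℕ) : Prop := IsReducedWord (wordProd a) a

/-- Increment the entry of `a` at position `m`. -/
def incrAt (a : List ℕ) (m : ℕ) : List ℕ := a.set m (a.getD m 0 + 1)

/-- The (upward) Little bump `L_{ij}` as a relation on biwords: starting at the position
`m_1` where wires `i` and `j` cross, repeatedly increment the current entry; stop when the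
bottom word becomes reduced, and otherwise move to the unique other position whose crossing
involves the same pair of wires. -/
def LittleBumpRel (i j : ℕ) (P P' : Biword) : Prop :=
  P'.top = P.top ∧
  ∃ ms : List ℕ, ∃ ws : List (List ℕ),
    ms ≠ [] ∧
    ws.length = ms.length + 1 ∧
    ws.getD 0 [] = P.bot ∧
    ws.getLastD [] = P'.bot ∧
    (∀ t : ℕ, t < ms.length → ws.getD (t + 1) [] = incrAt (ws.getD t []) (ms.getD t 0)) ∧
    crossingRefl P.bot (ms.getD 0 0) = tT i j ∧
    (∀ t : ℕ, t + 1 < ms.length →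
      ¬ IsReducedSelf (ws.getD (t + 1) []) ∧
      ms.getD (t + 1) 0 ≠ ms.getD t 0 ∧
      crossingRefl (ws.getD (t + 1) []) (ms.getD t 0)
        = crossingRefl (ws.getD (t + 1) []) (ms.getD (t + 1) 0)) ∧
    IsReducedSelf P'.bot

/-! ### Huang bumps -/

/-- Least offset `t ≥ 1` satisfying `p` (searched up to `bound + 1`). -/
def leastOff (p : ℕ → Bool) (bound : ℕ) : ℕ :=
  ((List.range' 1 (bound + 1)).filter p).headD 1

/-- The southeast corner `(x + k, y + l)` of the min-droop at `(x, y)`: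
`k, l ≥ 1` minimal with `(x+k, y)` and `(x, y+l)` not crossing tiles. -/
def minDroopCorner (g : Grid) (x y : ℕ) : ℕ × ℕ :=
  (x + leastOff (fun k => !(g.tile (x + k) y == Tile.cross)) g.n,
   y + leastOff (fun l => !(g.tile x (y + l) == Tile.cross)) g.n)

/-- The min-droop at `(x, y)`: droop the ⌐-turn at `(x, y)` into `(x+k, y+l)`. -/
def minDroopT (g : Grid) (x y : ℕ) : Grid :=
  let k := leastOff (fun k => !(g.tile (x + k) y == Tile.cross)) g.n
  let l := leastOff (fun l => !(g.tile x (y + l) == Tile.cross)) g.n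
  ⟨g.n, fun a b =>
    let t := g.tile a b
    if a = x ∧ b = y then
      (match t with | Tile.se => Tile.blank | Tile.bump => Tile.nw | _ => t)
    else if a = x + k ∧ b = y then (match t with | Tile.vert => Tile.se | _ => t)
    else if a = x ∧ b = y + l then
      (match t with | Tile.horiz => Tile.se | Tile.nw => Tile.vert | _ => t)
    else if a = x + k ∧ b = y + l then
      (match t with | Tile.blank => Tile.nw | Tile.se => Tile.bump | _ => t)
    else if b = y ∧ x < a ∧ a < x + k then
      (match t with | Tile.cross => Tile.horiz | Tile.vert => Tile.blank | _ => t)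
    else if a = x ∧ y < b ∧ b < y + l then
      (match t with | Tile.cross => Tile.vert | Tile.horiz => Tile.blank | _ => t)
    else if a = x + k ∧ y < b ∧ b < y + l then
      (match t with | Tile.blank => Tile.horiz | Tile.vert => Tile.cross | _ => t)
    else if b = y + l ∧ x < a ∧ a < x + k then
      (match t with | Tile.blank => Tile.vert | Tile.horiz => Tile.cross | _ => t)
    else t⟩

/-- Replace a single tile. -/
def setTile (g : Grid) (x y : ℕ) (t : Tile) : Grid :=
  ⟨g.n, fun a b => if a = x ∧ b = y then t else g.tile a b⟩

/-- Pipe `c` passes through `(x, y)` (Boolean). -/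
def onPath (g : Grid) (c : ℕ) (x y : ℕ) : Bool :=
  decide ((x, y, Dir.north) ∈ pipePath g c) || decide ((x, y, Dir.east) ∈ pipePath g c)

/-- The position of the crossing tile where pipes `c` and `c'` cross, if any. -/
def findCrossing (g : Grid) (c c' : ℕ) : Option (ℕ × ℕ) :=
  (pipePath g c).findSome? (fun s =>
    if (g.tile s.1 s.2.1 == Tile.cross) && onPath g c' s.1 s.2.1 then some (s.1, s.2.1)
    else none)

/-- The column of the ⌐-turn of pipe `c` in row `row`, if any. -/
def seTurnCol (g : Grid) (c row : ℕ) : Option ℕ :=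
  (pipePath g c).findSome? (fun s =>
    if s.1 = row ∧ s.2.2 = Dir.north ∧
        (g.tile s.1 s.2.1 = Tile.se ∨ g.tile s.1 s.2.1 = Tile.bump) then some s.2.1
    else none)

/-- The iteration of the Huang bump: min-droops and cross-bump-swaps until a bump tile
is turned into a crossing tile. -/
def huangLoop (iPipe : ℕ) : ℕ → Grid → ℕ × ℕ → Grid
  | 0, g, _ => g
  | fuel + 1, g, (x, y) =>
    let c := minDroopCorner g x y
    let g1 := minDroopT g x y
    match g1.tile c.1 c.2 with
    | Tile.nw =>
      match seTurnCol g1 iPipe c.1 with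
      | some col => huangLoop iPipe fuel g1 (c.1, col)
      | none => g1
    | Tile.bump =>
      match backAux g1 (2 * g1.n + 2) c.1 c.2 false with
      | some q =>
        match findCrossing g1 iPipe q with
        | some z =>
          huangLoop iPipe fuel (setTile (setTile g1 c.1 c.2 Tile.cross) z.1 z.2 Tile.bump) z
        | none => setTile g1 c.1 c.2 Tile.cross
      | none => g1
    | _ => g1

/-- Fuel exceeding the number of states of the procedure. -/
def huangFuel (g : Grid) : ℕ := 7 ^ (g.n * g.n) * (g.n * g.n) + 2

/-- The Huang bump `H_{ij}`: replace the crossing of pipes `i` and `j` by a bump tile,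
then repeatedly min-droop and cross-bump-swap until a new crossing tile is created. -/
def huang (i j : ℕ) (g : Grid) : Grid :=
  match findCrossing g i j with
  | some z => huangLoop i (huangFuel g) (setTile g z.1 z.2 Tile.bump) z
  | none => g



def mkT (L : ℕ) (lam : ℕ → ℕ) (T : ℕ → ℕ → ℕ) : List (List ℕ) :=
  (List.range L).map fun r => (List.range (lam r)).map fun c => T r c

def updT (T : ℕ → ℕ → ℕ) (r c x : ℕ) : ℕ → ℕ → ℕ :=
  fun r' c' => if r' = r ∧ c' = c then x else T r' c'

theorem mkT_getD (L : ℕ) (lam : ℕ → ℕ) (T : ℕ → ℕ → ℕ) (hL : ∀ r, L ≤ r → lam r = 0) (r : ℕ) :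
    (mkT L lam T).getD r [] = (List.range (lam r)).map fun c => T r c := by
  unfold mkT
  rcases lt_or_ge r L with h | h
  · simp [List.getD_eq_getElem?_getD, h]
  · simp [List.getD_eq_getElem?_getD, h, hL r h]

theorem row_get (m : ℕ) (f : ℕ → ℕ) (c : ℕ) :
    ((List.range m).map f)[c]? = if c < m then some (f c) else none := by
  split_ifs with h
  · simp [h]
  · simp; omega

theorem mkT_congr (L : ℕ) (lam : ℕ → ℕ) (T T' : ℕ → ℕ → ℕ)
    (h : ∀ r c, r < L → c < lam r → T r c = T' r c) : mkT L lam T = mkT L lam T' := by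
  unfold mkT
  apply List.map_congr_left
  intro r hr
  apply List.map_congr_left
  intro c hc
  exact h r c (by simpa using hr) (by simpa using hc)

theorem setEntry_mkT (L : ℕ) (lam : ℕ → ℕ) (T : ℕ → ℕ → ℕ) (hL : ∀ r, L ≤ r → lam r = 0)
    (r c x : ℕ) : setEntry (mkT L lam T) r c x = mkT L lam (updT T r c x) := by
  unfold setEntry
  rw [mkT_getD _ _ _ hL]
  apply List.ext_getElem
  · simp [mkT]
  · intro i h1 h2
    simp only [mkT, List.length_set, List.length_map, List.length_range] at h1
    rw [List.getElem_set]
    split_ifs with h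
    · subst h
      apply List.ext_getElem
      · simp [mkT]
      · intro j h3 h4
        rw [List.getElem_set]
        simp only [mkT, List.getElem_map, List.getElem_range, updT]
        by_cases h5 : c = j
        · subst h5; simp
        · rw [if_neg h5, if_neg (by omega)]
    · simp only [mkT, List.getElem_map, List.getElem_range, updT]
      apply List.map_congr_left
      intro a _
      rw [if_neg]; omega

theorem jdt_right (L : ℕ) (lam : ℕ → ℕ) (T : ℕ → ℕ → ℕ) (hL : ∀ r, L ≤ r → lam r = 0)
    (f r c : ℕ) (h1 : c + 1 < lam r) (h2 : c < lam (r + 1) → T r (c + 1) < T (r + 1) c) :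
    jdtAux (f + 1) (mkT L lam T) r c = jdtAux f (mkT L lam (updT T r c (T r (c + 1)))) r (c + 1) := by
  rw [jdtAux, mkT_getD _ _ _ hL, mkT_getD _ _ _ hL, row_get, row_get, if_pos h1]
  split_ifs with h
  · simp only [if_pos (h2 h), setEntry_mkT _ _ _ hL]
  · simp only [setEntry_mkT _ _ _ hL]

theorem jdt_down (L : ℕ) (lam : ℕ → ℕ) (T : ℕ → ℕ → ℕ) (hL : ∀ r, L ≤ r → lam r = 0)
    (f r c : ℕ) (h1 : c < lam (r + 1)) (h2 : c + 1 < lam r → T (r + 1) c ≤ T r (c + 1)) :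
    jdtAux (f + 1) (mkT L lam T) r c = jdtAux f (mkT L lam (updT T r c (T (r + 1) c))) (r + 1) c := by
  rw [jdtAux, mkT_getD _ _ _ hL, mkT_getD _ _ _ hL, row_get, row_get, if_pos h1]
  split_ifs with h
  · simp only [if_neg (not_lt.mpr (h2 h)), setEntry_mkT _ _ _ hL]
  · simp only [setEntry_mkT _ _ _ hL]

theorem filter_range_pre (L L' : ℕ) (p : ℕ → Bool) (hp : ∀ r, r < L → (p r = true ↔ r < L'))
    (hLL : L' ≤ L) : (List.range L).filter p = List.range L' := by
  induction L generalizing L' with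
  | zero => have : L' = 0 := by omega
            subst this; rfl
  | succ L ih =>
    rw [List.range_succ, List.filter_append]
    rcases Nat.lt_or_ge L L' with h | h
    · have : L' = L + 1 := by omega
      subst this
      have h1 : (List.range L).filter p = List.range L :=
        ih L (fun r hr => by have := hp r (by omega); simp [this]; omega) le_rfl
      rw [h1, List.range_succ]
      have := (hp L (by omega)).2 (by omega)
      simp [this]
    · rw [ih L' (fun r hr => hp r (by omega)) h]
      have : p L = false := by
        have := hp L (by omega)
        cases hh : p L
        · rfl
        · rw [hh] at this; simp at this; omega
      simp [this]

theorem jdt_end (L L' : ℕ) (lam : ℕ → ℕ) (T : ℕ → ℕ → ℕ) (hL : ∀ r, L ≤ r → lam r = 0)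
    (f r c : ℕ) (h1 : lam r = c + 1) (h2 : lam (r + 1) ≤ c)
    (hL' : ∀ r', r' < L → (0 < (if r' = r then c else lam r') ↔ r' < L')) (hLL : L' ≤ L) :
    jdtAux (f + 1) (mkT L lam T) r c = mkT L' (fun r' => if r' = r then c else lam r') T := by
  rw [jdtAux, mkT_getD _ _ _ hL, mkT_getD _ _ _ hL, row_get, row_get, if_neg (by omega),
    if_neg (by omega)]
  simp only
  have e : (mkT L lam T).set r (((List.range (lam r)).map fun c => T r c).take c)
      = mkT L (fun r' => if r' = r then c else lam r') T := by
    apply List.ext_getElem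
    · simp [mkT]
    · intro i h3 h4
      rw [List.getElem_set]
      split_ifs with h
      · subst h
        simp only [mkT, List.getElem_map, List.getElem_range, if_true]
        rw [← List.map_take, List.take_range, min_eq_left (by omega)]
      · simp only [mkT, List.getElem_map, List.getElem_range]
        rw [if_neg (by omega)]
  rw [e, mkT, List.filter_map, mkT]
  congr 1
  apply filter_range_pre _ _ _ _ hLL
  intro r' hr'
  rw [← hL' r' hr']
  simp only [Function.comp]
  cases hh : (if r' = r then c else lam r') with
  | zero => simp
  | succ m => simp [List.range_succ]

theorem jdt_congr (L : ℕ) (lam : ℕ → ℕ) (T T' : ℕ → ℕ → ℕ) (hL : ∀ r, L ≤ r → lam r = 0)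
    (f r c : ℕ) (hT : ∀ r' c', r' < L → c' < lam r' → ¬ (r' = r ∧ c' = c) → T r' c' = T' r' c') :
    jdtAux (f + 1) (mkT L lam T) r c = jdtAux (f + 1) (mkT L lam T') r c := by
  have key : ∀ x, mkT L lam (updT T r c x) = mkT L lam (updT T' r c x) := by
    intro x
    apply mkT_congr
    intro r' c' h1 h2
    unfold updT
    split_ifs with h
    · rfl
    · exact hT r' c' h1 h2 h
  have lt : ∀ {r' c'}, c' < lam r' → r' < L := by
    intro r' c' h
    by_contra hh
    have := hL r' (by omega); omega
  rw [jdtAux, jdtAux]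
  simp only [mkT_getD _ _ _ hL, row_get, setEntry_mkT _ _ _ hL]
  by_cases a : c + 1 < lam r <;> by_cases b : c < lam (r + 1)
  · simp only [a, b, if_true, hT r (c+1) (lt a) a (by omega), hT (r+1) c (lt b) b (by omega), key]
  · simp only [a, b, if_true, if_false, hT r (c+1) (lt a) a (by omega), key]
  · simp only [a, b, if_true, if_false, hT (r+1) c (lt b) b (by omega), key]
  · simp only [a, b, if_false]
    congr 1
    have : ((List.range (lam r)).map fun c => T r c).take c
        = ((List.range (lam r)).map fun c => T' r c).take c := by
      rw [← List.map_take, List.take_range, ← List.map_take, List.take_range]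
      apply List.map_congr_left
      intro d hd
      simp at hd
      exact hT r d (lt hd.2) hd.2 (by omega)
    rw [this]
    apply List.ext_getElem
    · simp [mkT]
    · intro i h3 h4
      rw [List.getElem_set, List.getElem_set]
      split_ifs with h
      · rfl
      · simp only [mkT, List.getElem_map, List.getElem_range]
        apply List.map_congr_left
        intro d hd
        exact hT i d (by simpa [mkT] using h3) (by simpa using hd) (by omega)

/-- Slide right along equal entries. -/
theorem jdt_slide (L : ℕ) (lam : ℕ → ℕ) (T : ℕ → ℕ → ℕ) (hL : ∀ r, L ≤ r → lam r = 0)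
    (r v : ℕ) (hcol : ∀ c, c < lam (r + 1) → T r c < T (r + 1) c) (s f c : ℕ) (h1 : c + s < lam r)
    (hv : ∀ t, t ≤ s → T r (c + t) = v) :
    jdtAux (f + s) (mkT L lam T) r c = jdtAux f (mkT L lam T) r (c + s) := by
  induction s generalizing c with
  | zero => rfl
  | succ s ih =>
    have e0 := hv 0 (by omega)
    have e1 := hv 1 (by omega)
    rw [← add_assoc, jdt_right _ _ _ hL _ _ _ (by omega)
      (by intro h; rw [e1, ← e0]; exact hcol c h)]
    have : updT T r c (T r (c + 1)) = T := by
      funext a b; unfold updT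
      split_ifs with h
      · obtain ⟨rfl, rfl⟩ := h; rw [e1, ← e0]; rfl
      · rfl
    rw [this, ih (c + 1) (by omega)
      (fun t ht => by have := hv (t + 1) (by omega); rwa [show c + 1 + t = c + (t+1) by omega])]
    congr 1; omega

theorem jdt_downs (L : ℕ) (lam : ℕ → ℕ) (T : ℕ → ℕ → ℕ) (hL : ∀ r, L ≤ r → lam r = 0)
    (r c s f : ℕ) (h1 : ∀ t, 1 ≤ t → t ≤ s → c < lam (r + t))
    (h2 : ∀ t, t < s → c + 1 < lam (r + t) → T (r + t + 1) c ≤ T (r + t) (c + 1)) :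
    jdtAux (f + s) (mkT L lam T) r c
      = jdtAux f (mkT L lam (fun r' c' => if c' = c ∧ r ≤ r' ∧ r' < r + s then T (r' + 1) c'
          else T r' c')) (r + s) c := by
  induction s generalizing f with
  | zero =>
    have : (fun r' c' => if c' = c ∧ r ≤ r' ∧ r' < r + 0 then T (r' + 1) c' else T r' c') = T := by
      funext a b; rw [if_neg]; omega
    rw [this]; rfl
  | succ s ih =>
    rw [show f + (s + 1) = (f + 1) + s by omega, ih (f + 1) (fun t a b => h1 t a (by omega))
      (fun t a => h2 t (by omega)), jdt_down _ _ _ hL]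
    · rw [← add_assoc]
      congr 2
      funext a b
      unfold updT
      by_cases h : a = r + s ∧ b = c
      · obtain ⟨rfl, rfl⟩ := h
        simp
      · rw [if_neg h]
        beta_reduce
        by_cases h' : b = c ∧ r ≤ a ∧ a < r + s
        · rw [if_pos h', if_pos (by omega)]
        · rw [if_neg h', if_neg (by omega)]
    · exact h1 (s + 1) (by omega) le_rfl
    · intro h
      have := h2 s (by omega) h
      simpa using this



structure GP (w : Perm') (k n : ℕ) : Prop where
  k1 : 1 ≤ k
  kn : k < n
  w0 : w 0 = 0
  fx : ∀ x, n < x → w x = x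
  inc1 : ∀ i j, 1 ≤ i → i < j → j ≤ k → w i < w j
  inc2 : ∀ i j, k < i → i < j → w i < w j

def lamW (w : Perm') (k r : ℕ) : ℕ := w (k - r) - (k - r)

theorem GP.add_le {w : Perm'} {k n : ℕ} (h : GP w k n) (i d : ℕ) (hi : i + d ≤ k) :
    w i + d ≤ w (i + d) := by
  induction d with
  | zero => simp
  | succ d ih =>
    have := ih (by omega)
    rcases Nat.eq_zero_or_pos (i + d) with h0 | h0
    · have hd : d = 0 := by omega
      have hi0 : i = 0 := by omega
      subst hd; subst hi0
      rw [h.w0]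
      have : w (0 + (0 + 1)) ≠ w 0 := by intro hh; have := w.injective hh; omega
      rw [h.w0] at this; omega
    · have := h.inc1 (i + d) (i + d + 1) h0 (by omega) (by omega)
      rw [show i + (d + 1) = i + d + 1 by omega]; omega

theorem GP.le {w : Perm'} {k n : ℕ} (h : GP w k n) (i : ℕ) (hi : i ≤ k) : i ≤ w i := by
  have := h.add_le 0 i (by omega)
  rw [h.w0] at this; simpa using this

theorem GP.lam_anti {w : Perm'} {k n : ℕ} (h : GP w k n) (r s : ℕ) (hrs : r ≤ s) :
    lamW w k s ≤ lamW w k r := by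
  unfold lamW
  have := h.add_le (k - s) ((k - r) - (k - s)) (by omega)
  rw [show k - s + ((k - r) - (k - s)) = k - r by omega] at this
  omega

theorem GP.code1 {w : Perm'} {k n : ℕ} (h : GP w k n) (i : ℕ) (h1 : 1 ≤ i) (hi : i ≤ k) :
    codeOf w i = w i - i := by
  unfold codeOf
  have hA : Set.ncard {j | w j < w i} = w i := by
    have : {j | w j < w i} = w.symm '' (Set.Iio (w i)) := by
      ext j; simp
    rw [this, Set.ncard_image_of_injective _ w.symm.injective]
    rw [← Finset.coe_Iio, Set.ncard_coe_finset]; simp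
  have hfin : {j | w j < w i}.Finite := by
    have : {j | w j < w i} = w.symm '' (Set.Iio (w i)) := by
      ext j; simp
    rw [this]; exact (Set.finite_Iio _).image _
  have hsub : Set.Iio i ⊆ {j | w j < w i} := by
    intro j hj
    simp only [Set.mem_Iio, Set.mem_ofPred_eq] at *
    have := h.add_le j (i - j) (by omega)
    rw [show j + (i - j) = i by omega] at this
    omega
  have hd : {j | i < j ∧ w j < w i} = {j | w j < w i} \ Set.Iio i := by
    ext j
    simp only [Set.mem_ofPred_eq, Set.mem_sdiff, Set.mem_Iio]
    constructor
    · rintro ⟨a, b⟩; exact ⟨b, by omega⟩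
    · rintro ⟨a, b⟩
      refine ⟨?_, a⟩
      rcases eq_or_lt_of_le (not_lt.mp b) with e | e
      · subst e; omega
      · exact e
  rw [hd]
  change Set.ncard _ = _
  rw [Set.ncard_sdiff hsub (Set.finite_Iio i), hA]
  rw [← Finset.coe_Iio, Set.ncard_coe_finset]; simp

theorem GP.code2 {w : Perm'} {k n : ℕ} (h : GP w k n) (i : ℕ) (hi : k < i) :
    codeOf w i = 0 := by
  unfold codeOf
  have : {j | i < j ∧ w j < w i} = ∅ := by
    ext j
    simp only [Set.mem_ofPred_eq, Set.mem_empty_iff_false, iff_false, not_and, not_lt]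
    intro hj
    exact (h.inc2 i j hi hj).le
  rw [this]; simp

theorem insDesc_perm (x : ℕ) (l : List ℕ) : (insDesc x l).Perm (x :: l) := by
  induction l with
  | nil => exact List.Perm.refl _
  | cons y ys ih =>
    unfold insDesc
    split_ifs
    · exact List.Perm.refl _
    · exact (List.Perm.cons y ih).trans (List.Perm.swap x y ys)

theorem insDesc_sorted (x : ℕ) (l : List ℕ) (hl : l.Pairwise (fun a b => b ≤ a)) :
    (insDesc x l).Pairwise (fun a b => b ≤ a) := by
  induction l with
  | nil => simp [insDesc]
  | cons y ys ih =>
    unfold insDesc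
    rw [List.pairwise_cons] at hl
    split_ifs with h
    · rw [List.pairwise_cons, List.pairwise_cons]
      refine ⟨?_, hl⟩
      intro a ha
      rcases List.mem_cons.1 ha with rfl | ha
      · omega
      · have := hl.1 a ha; omega
    · rw [List.pairwise_cons]
      refine ⟨?_, ih hl.2⟩
      intro a ha
      rcases List.mem_cons.1 ((insDesc_perm x ys).mem_iff.1 ha) with rfl | ha
      · omega
      · exact hl.1 a ha

theorem sortDesc_perm (l : List ℕ) : (sortDesc l).Perm l := by
  induction l with
  | nil => exact List.Perm.refl _
  | cons y ys ih => exact (insDesc_perm y _).trans (List.Perm.cons y ih)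

theorem sortDesc_sorted (l : List ℕ) : (sortDesc l).Pairwise (fun a b => b ≤ a) := by
  induction l with
  | nil => exact List.Pairwise.nil
  | cons y ys ih => exact insDesc_sorted y _ ih

theorem GP.shape {w : Perm'} {k n : ℕ} (h : GP w k n) (L : ℕ) (hLk : L ≤ k)
    (hL : ∀ r, r < k → (0 < lamW w k r ↔ r < L)) :
    shapeOf w n = (List.range L).map (lamW w k) := by
  have hz : ∀ r, k ≤ r → lamW w k r = 0 := by
    intro r hr; unfold lamW; rw [show k - r = 0 by omega, h.w0]
  have e : sortDesc ((List.range' 1 n).map (codeOf w)) = (List.range n).map (lamW w k) := by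
    apply List.Perm.eq_of_pairwise (le := fun a b => b ≤ a)
    · intro a b _ _ h1 h2; omega
    · exact sortDesc_sorted _
    · rw [List.pairwise_map]
      apply List.Pairwise.imp _ (List.pairwise_lt_range (n := n))
      intro a b hab
      exact h.lam_anti a b hab.le
    · refine (sortDesc_perm _).trans ?_
      have e1 : List.range' 1 n = List.range' 1 k ++ List.range' (k + 1) (n - k) := by
        have := List.range'_append_1 (s := 1) (m := k) (n := n - k)
        rw [show k + (n - k) = n by have := h.kn; omega] at this
        rw [← this, add_comm 1 k]
      have e2 : List.range n = List.range k ++ List.range' k (n - k) := by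
        have := List.range'_append_1 (s := 0) (m := k) (n := n - k)
        rw [show k + (n - k) = n by have := h.kn; omega] at this
        rw [List.range_eq_range', ← this, List.range_eq_range', zero_add]
      rw [e1, e2, List.map_append, List.map_append]
      apply List.Perm.append
      · have : (List.range' 1 k).map (codeOf w) = ((List.range k).map (lamW w k)).reverse := by
          apply List.ext_getElem
          · simp
          · intro i h1 h2
            simp only [List.length_map, List.length_range'] at h1
            simp only [List.getElem_map, List.getElem_range', List.getElem_reverse,
              List.getElem_range, List.length_map, List.length_range]
            rw [h.code1 _ (by omega) (by omega)]
            unfold lamW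
            rw [show k - (k - 1 - i) = 1 + 1 * i by omega]
        rw [this]
        exact List.reverse_perm _
      · have : (List.range' (k+1) (n - k)).map (codeOf w)
            = (List.range' k (n - k)).map (lamW w k) := by
          apply List.ext_getElem
          · simp
          · intro i h1 h2
            simp only [List.getElem_map, List.getElem_range']
            rw [h.code2 _ (by omega), hz _ (by omega)]
        rw [this]
  unfold shapeOf
  rw [e, List.filter_map]
  congr 1
  apply filter_range_pre
  · intro r hr
    simp only [Function.comp, decide_eq_true_eq]
    rcases lt_or_ge r k with h1 | h1
    · exact hL r h1
    · rw [hz r h1]; omega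
  · have := h.kn; omega

theorem GP.exL {w : Perm'} {k n : ℕ} (h : GP w k n) :
    ∃ L, L ≤ k ∧ (∀ r, 0 < lamW w k r ↔ r < L) := by
  classical
  have hz : ∀ r, k ≤ r → lamW w k r = 0 := by
    intro r hr; unfold lamW; rw [show k - r = 0 by omega, h.w0]
  have ex : ∃ r, lamW w k r = 0 := ⟨k, hz k le_rfl⟩
  refine ⟨Nat.find ex, Nat.find_min' ex (hz k le_rfl), fun r => ⟨fun hr => ?_, fun hr => ?_⟩⟩
  · by_contra hh
    have := h.lam_anti _ r (not_lt.mp hh)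
    rw [Nat.find_spec ex] at this
    omega
  · have := Nat.find_min ex hr
    omega



structure Top (g : Grid) (R : ℕ → ℕ → ℕ) (k n : ℕ) : Prop where
  kn : k < n
  gn : g.n = n
  out : ∀ i j, ¬ InGrid g i j → g.tile i j = Tile.horiz
  R0 : ∀ j, R 0 j = 0
  Rc : ∀ i, i ≤ k → R i 0 = i
  Rn : ∀ i j, i ≤ k → n ≤ j → R i j = 0
  nc : ∀ i j, i < k → j < n → g.tile (i+1) (j+1) ≠ Tile.cross ∧ g.tile (i+1) (j+1) ≠ Tile.bump
  eN : ∀ i j, i < k → j < n → R i (j+1) + (hasN (g.tile (i+1) (j+1))).toNat = R i j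
  eS : ∀ i j, i < k → j < n → R (i+1) (j+1) + (hasS (g.tile (i+1) (j+1))).toNat = R (i+1) j
  eW : ∀ i j, i < k → j < n → R (i+1) j + (hasW (g.tile (i+1) (j+1))).toNat = R i j + 1
  eE : ∀ i j, i < k → j < n → R (i+1) (j+1) + (hasE (g.tile (i+1) (j+1))).toNat = R i (j+1) + 1

noncomputable def TR (R : ℕ → ℕ → ℕ) (r c : ℕ) : ℕ := sInf {i | r < R i (i + c - r)}

theorem Bool.toNat_le1 (b : Bool) : b.toNat ≤ 1 := by cases b <;> simp

namespace Top
variable {g : Grid} {R : ℕ → ℕ → ℕ} {k n : ℕ}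

theorem right (h : Top g R k n) (i j : ℕ) (hi : i ≤ k) :
    R i (j+1) ≤ R i j ∧ R i j ≤ R i (j+1) + 1 := by
  rcases i with _ | i
  · simp [h.R0]
  · rcases lt_or_ge j n with hj | hj
    · have := h.eS i j (by omega) hj
      have := Bool.toNat_le1 (hasS (g.tile (i+1) (j+1)))
      omega
    · simp [h.Rn (i+1) j hi hj, h.Rn (i+1) (j+1) hi (by omega)]

theorem down (h : Top g R k n) (i j : ℕ) (hi : i < k) :
    R i j ≤ R (i+1) j ∧ R (i+1) j ≤ R i j + 1 := by
  rcases lt_or_ge j n with hj | hj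
  · have := h.eW i j (by omega) hj
    have := Bool.toNat_le1 (hasW (g.tile (i+1) (j+1)))
    omega
  · simp [h.Rn (i+1) j (by omega) hj, h.Rn i j (by omega) (by omega)]

theorem blank_iff (h : Top g R k n) (i j : ℕ) (hi : i < k) (hj : j < n) :
    (g.tile (i+1) (j+1) = Tile.blank ↔ R (i+1) (j+1) = R i j + 1) ∧
    (g.tile (i+1) (j+1) ≠ Tile.blank ↔ R (i+1) (j+1) = R i j) := by
  have h1 := h.eW i j hi hj
  have h2 := h.eS i j hi hj
  have h3 := h.nc i j hi hj
  cases ht : g.tile (i+1) (j+1) <;> simp_all [hasW, hasS] <;> omega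

theorem diag (h : Top g R k n) (i j : ℕ) (hi : i < k) :
    R i j ≤ R (i+1) (j+1) ∧ R (i+1) (j+1) ≤ R i j + 1 := by
  rcases lt_or_ge j n with hj | hj
  · have := h.blank_iff i j hi hj
    by_cases hb : g.tile (i+1) (j+1) = Tile.blank
    · have := this.1.1 hb; omega
    · have := this.2.1 hb; omega
  · simp [h.Rn (i+1) (j+1) (by omega) (by omega), h.Rn i j (by omega) (by omega)]

theorem le_self (h : Top g R k n) (i j : ℕ) (hi : i ≤ k) : R i j ≤ i := by
  induction j with
  | zero => exact (h.Rc i hi).le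
  | succ j ih => have := h.right i j hi; omega

theorem D_step (h : Top g R k n) (r c i : ℕ) (hi : i < k) :
    R i (i + c - r) ≤ R (i+1) (i+1 + c - r) ∧ R (i+1) (i+1 + c - r) ≤ R i (i + c - r) + 1 := by
  rcases lt_or_ge (i + c) r with hh | hh
  · rw [show i + c - r = 0 by omega, show i + 1 + c - r = 0 by omega, h.Rc _ (by omega),
      h.Rc _ (by omega)]
    omega
  · rw [show i + 1 + c - r = (i + c - r) + 1 by omega]
    exact h.diag i _ hi

theorem D_mono (h : Top g R k n) (r c i i' : ℕ) (hi : i ≤ i') (hi' : i' ≤ k) :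
    R i (i + c - r) ≤ R i' (i' + c - r) := by
  induction i' with
  | zero => have : i = 0 := by omega
            subst this; rfl
  | succ m ih =>
    rcases eq_or_lt_of_le hi with e | e
    · rw [e]
    · exact (ih (by omega) (by omega)).trans (h.D_step r c m (by omega)).1

theorem TR_spec (h : Top g R k n) (r c : ℕ) (hc : r < R k (k + c - r)) :
    TR R r c ≤ k ∧ r < R (TR R r c) (TR R r c + c - r) ∧
    ∀ i, i < TR R r c → R i (i + c - r) ≤ r := by
  have hne : {i | r < R i (i + c - r)}.Nonempty := ⟨k, hc⟩
  refine ⟨Nat.sInf_le hc, Nat.sInf_mem hne, fun i hi => ?_⟩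
  have := Nat.notMem_of_lt_sInf hi
  simpa using this

theorem TR_lt (h : Top g R k n) (r c i : ℕ) (hc : r < R k (k + c - r)) (hi : i ≤ k)
    (h1 : R i (i + c - r) ≤ r) : i < TR R r c := by
  by_contra hh
  have h2 := h.TR_spec r c hc
  have := h.D_mono r c _ i (not_lt.mp hh) hi
  omega

theorem TR_le (r c i : ℕ) (h1 : r < R i (i + c - r)) : TR R r c ≤ i := Nat.sInf_le h1

theorem TR_eq (h : Top g R k n) (r c i : ℕ) (hi : i < k) 
    (h1 : r < R (i+1) (i+1 + c - r)) (h2 : R i (i + c - r) ≤ r) : TR R r c = i + 1 := by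
  have h3 : r < R k (k + c - r) := lt_of_lt_of_le h1 (h.D_mono r c (i+1) k (by omega) le_rfl)
  have := h.TR_lt r c i h3 (by omega) h2
  have := TR_le (R := R) r c (i+1) h1
  omega

/-- full description of an entry -/
theorem TR_full (h : Top g R k n) (r c : ℕ) (hc : r < R k (k + c - r)) :
    ∃ i, i < k ∧ TR R r c = i + 1 ∧ R i (i + c - r) = r ∧ R (i+1) (i+1 + c - r) = r + 1 := by
  obtain ⟨a, b, d⟩ := h.TR_spec r c hc
  rcases hT : TR R r c with _ | i
  · rw [hT, h.R0] at b; omega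
  · rw [hT] at a b
    have h1 := d i (by omega)
    have h2 := h.D_step r c i (by omega)
    exact ⟨i, by omega, rfl, by omega, by omega⟩

theorem col_strict (h : Top g R k n) (r c : ℕ) (hc : r + 1 < R k (k + c - (r + 1))) :
    TR R r c < TR R (r + 1) c := by
  obtain ⟨i, hi, hT, h1, h2⟩ := h.TR_full (r+1) c hc
  rw [hT]
  have := (h.down i (i + 1 + c - (r + 1)) hi).2
  have : r < R i (i + c - r) := by
    rw [show i + c - r = i + 1 + c - (r + 1) by omega]; omega
  have := TR_le (R := R) r c i this
  omega

theorem pa_aux (h : Top g R k n) (j m : ℕ) (hm : m ≤ k) (hj : j < n) :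
    ((List.range' 1 m).filter (fun x => hasE (g.tile x (j+1)))).length + R m (j+1) = m := by
  induction m with
  | zero => simp [h.R0]
  | succ m ih =>
    rw [List.range'_1_concat, List.filter_append, List.length_append]
    have h1 := ih (by omega)
    have h2 := h.eE m j (by omega) hj
    rw [add_comm 1 m]
    cases hh : hasE (g.tile (m+1) (j+1)) <;> simp [hh] at h2 ⊢ <;> omega

theorem pa (h : Top g R k n) (i j : ℕ) (hi : i < k) (hj : j < n) :
    pipesAbove g (i+1) (j+1) + R i (j+1) = i := by
  have h0 := h.pa_aux j i hi.le hj
  suffices hs : pipesAbove g (i+1) (j+1)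
      = ((List.range' 1 i).filter (fun x => hasE (g.tile x (j+1)))).length by omega
  unfold pipesAbove
  rw [h.gn]
  have e1 : List.range' 1 n = List.range' 1 i ++ List.range' (i + 1) (n - i) := by
    have := List.range'_append_1 (s := 1) (m := i) (n := n - i)
    rw [show i + (n - i) = n by have := h.kn; omega] at this
    rw [← this, add_comm 1 i]
  rw [e1, List.filter_append, List.length_append]
  have e2 : (List.range' (i + 1) (n - i)).filter
      (fun x => decide (x < i + 1) && hasE (g.tile x (j+1))) = [] := by
    rw [List.filter_eq_nil_iff]
    intro a ha
    rw [List.mem_range'_1] at ha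
    simp; omega
  rw [e2, List.length_nil, add_zero]
  congr 1
  apply List.filter_congr
  intro x hx
  rw [List.mem_range'_1] at hx
  have : x < i + 1 := by omega
  simp [this]

def diagF (g : Grid) (d : ℤ) : ℕ → Option (ℕ × ℕ) := fun (i : ℕ) =>
    let jz : ℤ := (i : ℤ) + d
    if 1 ≤ jz ∧ jz ≤ (g.n : ℤ) then
      (if g.tile i jz.toNat = Tile.blank then some (i, jz.toNat) else none)
    else none

theorem diag_len (h : Top g R k n) (r c m : ℕ) (hm : m ≤ k) :
    ((List.range' 1 m).filterMap (diagF g ((c:ℤ) - r))).length + min m (r - c)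
      = R m (m + c - r) := by
  induction m with
  | zero => simp [h.R0]
  | succ m ih =>
    have h1 := ih (by omega)
    rw [List.range'_1_concat, List.filterMap_append, List.length_append]
    rw [add_comm 1 m]
    rcases lt_or_ge (m + c) r with hh | hh
    · have e : diagF g ((c:ℤ) - r) (m+1) = none := by
        unfold diagF; simp only; rw [if_neg]; push_cast; omega
      rw [show m + c - r = 0 by omega, h.Rc _ (by omega)] at h1
      rw [show m + 1 + c - r = 0 by omega, h.Rc _ hm]
      simp [e]
      omega
    · rw [show m + 1 + c - r = (m + c - r) + 1 by omega]
      rcases lt_or_ge (m + c - r) n with h3 | h3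
      · have h4 := h.blank_iff m (m + c - r) (by omega) h3
        have e0 : (((m + 1 : ℕ) : ℤ) + ((c:ℤ) - r)).toNat = m + c - r + 1 := by omega
        have h5 : diagF g ((c:ℤ) - r) (m+1)
            = if g.tile (m+1) (m + c - r + 1) = Tile.blank then some (m+1, m + c - r + 1) else none := by
          unfold diagF; simp only
          rw [if_pos, e0]
          rw [h.gn]; push_cast; omega
        by_cases hb : g.tile (m+1) (m + c - r + 1) = Tile.blank
        · have := h4.1.1 hb
          simp [h5, hb]; omega
        · have := h4.2.1 hb
          simp [h5, hb]; omega
      · have e : diagF g ((c:ℤ) - r) (m+1) = none := by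
          unfold diagF; simp only; rw [if_neg, ]; rw [h.gn]; push_cast; omega
        rw [h.Rn m _ (by omega) h3] at h1
        rw [h.Rn _ _ (by omega) (by omega)]
        have e2 : ([m+1].filterMap (diagF g ((c:ℤ) - r))) = [] := by simp [e]
        rw [e2, List.length_nil]
        have hcr : r - c = 0 := by
          rcases Nat.eq_zero_or_pos m with hm0 | hm0
          · omega
          · omega
        rw [hcr] at h1 ⊢
        simp at h1 ⊢
        exact h1

theorem weig (h : Top g R k n) (L : ℕ) (lam : ℕ → ℕ)
    (hcell : ∀ r c, r < L → c < lam r → r < R k (k + c - r)) :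
    weigandt g ((List.range L).map lam) = mkT L lam (TR R) := by
  unfold weigandt mkT
  rw [List.length_map, List.length_range]
  apply List.map_congr_left
  intro r hr
  rw [List.mem_range] at hr
  have : ((List.range L).map lam).getD r 0 = lam r := by
    simp [List.getD_eq_getElem?_getD, hr]
  rw [this]
  apply List.map_congr_left
  intro c hc
  rw [List.mem_range] at hc
  obtain ⟨i, hi, hT, h1, h2⟩ := h.TR_full r c (hcell r c hr hc)
  have hri : r ≤ i := by have := h.le_self i (i + c - r) (by omega); omega
  set j := i + c - r with hj
  rw [show i + 1 + c - r = j + 1 by omega] at h2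
  have hjn : j < n := by
    by_contra hh
    rw [h.Rn (i+1) (j+1) (by omega) (by omega)] at h2; omega
  have hb := ((h.blank_iff i j hi hjn).1).2 (by omega)
  have hlen := h.diag_len r c i (by omega)
  rw [← hj, h1] at hlen
  have e1 : List.range' 1 n = List.range' 1 i ++ ((i+1) :: List.range' (i + 2) (n - i - 1)) := by
    have := List.range'_append_1 (s := 1) (m := i) (n := n - i)
    rw [show i + (n - i) = n by have := h.kn; omega] at this
    rw [← this, add_comm 1 i, show n - i = (n - i - 1) + 1 by have := h.kn; omega,
      List.range'_succ]
    rfl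
  have hlist : blanksOnDiag g (((c + 1 : ℕ) : ℤ) - ((r + 1 : ℕ) : ℤ))
      = (List.range' 1 i).filterMap (diagF g ((c:ℤ) - r)) ++
        ((i+1, j+1) :: (List.range' (i + 2) (n - i - 1)).filterMap (diagF g ((c:ℤ) - r))) := by
    have : blanksOnDiag g (((c + 1 : ℕ) : ℤ) - ((r + 1 : ℕ) : ℤ))
        = (List.range' 1 n).filterMap (diagF g ((c:ℤ) - r)) := by
      unfold blanksOnDiag
      rw [h.gn]
      congr 1
      rw [show ((c + 1 : ℕ) : ℤ) - ((r + 1 : ℕ) : ℤ) = (c:ℤ) - r by push_cast; ring]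
      funext x
      unfold diagF
      rw [h.gn]
    rw [this, e1, List.filterMap_append, List.filterMap_cons]
    have : diagF g ((c:ℤ) - r) (i+1) = some (i+1, j+1) := by
      have e0 : (((i + 1 : ℕ) : ℤ) + ((c:ℤ) - r)).toNat = j + 1 := by omega
      unfold diagF; simp only
      rw [if_pos, e0, if_pos hb]
      rw [h.gn]; push_cast; omega
    rw [this]
  simp only
  rw [hlist, List.getD_eq_getElem?_getD, List.getElem?_append_right (by omega)]
  rw [show min (r+1) (c+1) - 1 - ((List.range' 1 i).filterMap (diagF g ((c:ℤ) - r))).length = 0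
    by omega]
  simp only [List.getElem?_cons_zero, Option.getD_some]
  have h5 := h.pa i j hi hjn
  have h6 := h.eN i j hi hjn
  rw [hb] at h6
  simp [hasN] at h6
  rw [hT]; omega

end Top


/-! #### Paths -/

/-- one step of a pipe -/
def stp (g : Grid) (s : ℕ × ℕ × Dir) : Option (ℕ × ℕ × Dir) :=
  match outDir (g.tile s.1 s.2.1) s.2.2 with
  | none => none
  | some Dir.north => if s.1 ≤ 1 then none else some (s.1 - 1, s.2.1, Dir.north)
  | some Dir.east => if g.n ≤ s.2.1 then none else some (s.1, s.2.1 + 1, Dir.east)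

/-- state of pipe `c` at time `t` -/
def stA (g : Grid) (c : ℕ) : ℕ → Option (ℕ × ℕ × Dir)
  | 0 => some (g.n, c, Dir.north)
  | t + 1 => (stA g c t).bind (stp g)

theorem stA_inv (g : Grid) (c t x y : ℕ) (d : Dir) (h : stA g c t = some (x, y, d)) :
    (d = Dir.north ∧ t = 0 ∧ x = g.n ∧ y = c) ∨
    (d = Dir.north ∧ ∃ t' d', t = t' + 1 ∧ stA g c t' = some (x + 1, y, d') ∧
      outDir (g.tile (x+1) y) d' = some Dir.north ∧ 1 ≤ x) ∨
    (d = Dir.east ∧ ∃ t' d' y', t = t' + 1 ∧ y = y' + 1 ∧ stA g c t' = some (x, y', d') ∧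
      outDir (g.tile x y') d' = some Dir.east ∧ y' < g.n) := by
  cases t with
  | zero => simp [stA] at h; left; obtain ⟨a, b, e⟩ := h; simp [a, b, e]
  | succ t =>
    right
    simp only [stA] at h
    rw [Option.bind_eq_some_iff] at h
    obtain ⟨⟨x', y', d'⟩, h1, h2⟩ := h
    unfold stp at h2
    simp only at h2
    split at h2
    · simp at h2
    · rename_i ho
      split_ifs at h2 with hx
      simp only [Option.some.injEq, Prod.mk.injEq] at h2
      obtain ⟨rfl, rfl, rfl⟩ := h2
      left
      have e : x' - 1 + 1 = x' := by omega
      refine ⟨rfl, t, d', rfl, ?_, ?_, by omega⟩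
      · rw [e]; exact h1
      · rw [e]; exact ho
    · rename_i ho
      split_ifs at h2 with hx
      simp only [Option.some.injEq, Prod.mk.injEq] at h2
      obtain ⟨rfl, rfl, rfl⟩ := h2
      right
      exact ⟨rfl, t, d', y', rfl, rfl, h1, ho, by omega⟩

theorem stA_bd (g : Grid) (c : ℕ) (hc : 1 ≤ c) (hc' : c ≤ g.n) (t : ℕ) :
    ∀ x y d, stA g c t = some (x, y, d) → 1 ≤ x ∧ x ≤ g.n ∧ c ≤ y ∧ y ≤ g.n ∧ t + x + c = g.n + y := by
  induction t with
  | zero =>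
    intro x y d h
    rcases stA_inv g c 0 x y d h with ⟨_, _, h1, h2⟩ | ⟨_, t', d', h1, _⟩ | ⟨_, t', d', y', h1, _⟩
    · omega
    · omega
    · omega
  | succ t ih =>
    intro x y d h
    rcases stA_inv g c _ x y d h with ⟨_, h1, _⟩ | ⟨_, t', d', h1, h2, h3, h4⟩ |
        ⟨_, t', d', y', h1, h2, h3, h4, h5⟩
    · omega
    · obtain rfl : t = t' := by omega
      have := ih _ _ _ h2
      omega
    · obtain rfl : t = t' := by omega
      have := ih _ _ _ h3
      omega

theorem stA_tail (g : Grid) (c : ℕ) (t : ℕ) :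
    ∀ x y d, stA g c t = some (x, y, d) → ∀ f, t < f →
      traceAux g f g.n c Dir.north = traceAux g (f - t) x y d ∧
      (∀ z ∈ pathAux g (f - t) x y d, z ∈ pathAux g f g.n c Dir.north) := by
  induction t with
  | zero =>
    intro x y d h f hf
    simp [stA] at h
    obtain ⟨a, b, e⟩ := h
    subst a b e
    simp
  | succ t ih =>
    intro x y d h f hf
    simp only [stA] at h
    rw [Option.bind_eq_some_iff] at h
    obtain ⟨⟨x', y', d'⟩, h1, h2⟩ := h
    obtain ⟨i1, i2⟩ := ih x' y' d' h1 f (by omega)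
    rw [i1]
    have hf' : f - t = (f - (t+1)) + 1 := by omega
    rw [hf'] at i2 ⊢
    unfold stp at h2
    simp only at h2
    split at h2
    · simp at h2
    · rename_i ho
      split_ifs at h2 with hx
      simp only [Option.some.injEq, Prod.mk.injEq] at h2
      obtain ⟨rfl, rfl, rfl⟩ := h2
      simp only [pathAux, ho, if_neg hx] at i2
      refine ⟨?_, fun z hz => i2 z (List.mem_cons_of_mem _ hz)⟩
      simp only [traceAux, ho, if_neg hx]
    · rename_i ho
      split_ifs at h2 with hx
      simp only [Option.some.injEq, Prod.mk.injEq] at h2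
      obtain ⟨rfl, rfl, rfl⟩ := h2
      simp only [pathAux, ho, if_neg hx] at i2
      refine ⟨?_, fun z hz => i2 z (List.mem_cons_of_mem _ hz)⟩
      simp only [traceAux, ho, if_neg hx]

theorem trace_mono (g : Grid) (f : ℕ) : ∀ x y d e, traceAux g f x y d = some e →
    traceAux g (f+1) x y d = some e ∧ e ≤ x := by
  induction f with
  | zero => intro x y d e h; simp [traceAux] at h
  | succ f ih =>
    intro x y d e h
    unfold traceAux at h ⊢
    split at h
    · simp at h
    · rename_i ho
      split_ifs at h with hx
      simp only [ho, if_neg hx]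
      have := ih _ _ _ _ h
      exact ⟨this.1, by omega⟩
    · rename_i ho
      split_ifs at h with hx
      · simp only [ho, if_pos hx]
        simp at h
        simp [h]
      · simp only [ho, if_neg hx]
        exact ih _ _ _ _ h

theorem trace_mono' (g : Grid) (f s : ℕ) (x y d e) (h : traceAux g f x y d = some e) :
    traceAux g (f+s) x y d = some e := by
  induction s with
  | zero => exact h
  | succ s ih => exact (trace_mono g _ x y d e ih).1

theorem stA_passes (g : Grid) (c t x y : ℕ) (d : Dir) (hc : 1 ≤ c) (hc' : c ≤ g.n)
    (h : stA g c t = some (x, y, d)) : passes g c (x, y) := by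
  refine ⟨d, ?_⟩
  have hb := stA_bd g c hc hc' t x y d h
  have := (stA_tail g c t x y d h (2 * g.n + 2) (by omega)).2 (x, y, d)
  apply this
  rw [show 2 * g.n + 2 - t = (2 * g.n + 1 - t) + 1 by omega]
  unfold pathAux
  simp

/-- both pipes go through the crossing `z` -/
def CC (g : Grid) (p q : ℕ) (z : ℕ × ℕ) : Prop :=
  g.tile z.1 z.2 = Tile.cross ∧ (∃ t d, stA g p t = some (z.1, z.2, d)) ∧
    (∃ t d, stA g q t = some (z.1, z.2, d))

theorem out_two (T : Tile) (d d' : Dir) (hb : T ≠ Tile.bump) (h1 : outDir T d = some Dir.north)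
    (h2 : outDir T d' = some Dir.east) : T = Tile.cross := by
  cases T <;> cases d <;> cases d' <;> simp_all [outDir]

theorem in_two (T : Tile) (a b : Dir) (hb : T ≠ Tile.bump) (h1 : outDir T Dir.north = some a)
    (h2 : outDir T Dir.east = some b) : T = Tile.cross := by
  cases T <;> simp_all [outDir]

theorem backward (g : Grid) (hnb : ∀ i j, InGrid g i j → g.tile i j ≠ Tile.bump) (p q : ℕ)
    (hp : 1 ≤ p ∧ p ≤ g.n) (hq : 1 ≤ q ∧ q ≤ g.n) (t : ℕ) : ∀ t' x y d x' y' d',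
    stA g p t = some (x, y, d) → stA g q t' = some (x', y', d') → y + x' = y' + x → x < x' →
    p < q ∨ ∃ z : ℕ × ℕ, CC g p q z ∧ z.2 + x < z.1 + y := by
  induction t with
  | zero =>
    intro t' x y d x' y' d' h1 h2 h3 h4
    have b2 := stA_bd g q hq.1 hq.2 _ _ _ _ h2
    simp [stA] at h1
    omega
  | succ t ih =>
    intro t' x y d x' y' d' h1 h2 h3 h4
    have b1 := stA_bd g p hp.1 hp.2 _ _ _ _ h1
    have b2 := stA_bd g q hq.1 hq.2 _ _ _ _ h2
    rcases stA_inv g q _ _ _ _ h2 with ⟨_, e1, e2, e3⟩ | ⟨_, s', D', e1, e2, e3, e4⟩ |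
        ⟨_, s', D', v', e1, e2, e3, e4, e5⟩
    · left; omega
    · rcases stA_inv g p _ _ _ _ h1 with ⟨_, f1, f2, f3⟩ | ⟨_, s, D, f1, f2, f3, f4⟩ |
        ⟨_, s, D, v, f1, f2, f3, f4, f5⟩
      · omega
      · obtain rfl : t = s := by omega
        rcases ih s' _ _ _ _ _ _ f2 e2 (by omega) (by omega) with h | ⟨z, hz, hz'⟩
        · exact Or.inl h
        · exact Or.inr ⟨z, hz, by omega⟩
      · obtain rfl : t = s := by omega
        rcases ih s' _ _ _ _ _ _ f3 e2 (by omega) (by omega) with h | ⟨z, hz, hz'⟩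
        · exact Or.inl h
        · exact Or.inr ⟨z, hz, by omega⟩
    · rcases stA_inv g p _ _ _ _ h1 with ⟨_, f1, f2, f3⟩ | ⟨_, s, D, f1, f2, f3, f4⟩ |
        ⟨_, s, D, v, f1, f2, f3, f4, f5⟩
      · omega
      · obtain rfl : t = s := by omega
        rcases Nat.lt_or_ge (x+1) x' with hx | hx
        · rcases ih s' _ _ _ _ _ _ f2 e3 (by omega) (by omega) with h | ⟨z, hz, hz'⟩
          · exact Or.inl h
          · exact Or.inr ⟨z, hz, by omega⟩
        · right
          have e : x' = x + 1 := by omega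
          have e' : v' = y := by omega
          rw [e, e'] at e3 e4
          refine ⟨(x+1, y), ⟨?_, ⟨t, D, f2⟩, ⟨s', D', e3⟩⟩, by simp only; omega⟩
          exact out_two _ D D' (hnb _ _ ⟨by omega, by omega, by omega, by omega⟩) f3 e4
      · obtain rfl : t = s := by omega
        rcases ih s' _ _ _ _ _ _ f3 e3 (by omega) (by omega) with h | ⟨z, hz, hz'⟩
        · exact Or.inl h
        · exact Or.inr ⟨z, hz, by omega⟩

/-- unfolding a successful trace -/
theorem trace_step (g : Grid) (c t f x y : ℕ) (d : Dir) (e : ℕ) (hs : stA g c t = some (x, y, d))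
    (h : traceAux g (f+1) x y d = some e) :
    (outDir (g.tile x y) d = some Dir.north ∧ 1 < x ∧ stA g c (t+1) = some (x-1, y, Dir.north) ∧
      traceAux g f (x-1) y Dir.north = some e) ∨
    (outDir (g.tile x y) d = some Dir.east ∧ g.n ≤ y ∧ e = x) ∨
    (outDir (g.tile x y) d = some Dir.east ∧ y < g.n ∧ stA g c (t+1) = some (x, y+1, Dir.east) ∧
      traceAux g f x (y+1) Dir.east = some e) := by
  unfold traceAux at h
  split at h
  · simp at h
  · rename_i ho
    split_ifs at h with hx
    left
    refine ⟨ho, by omega, ?_, h⟩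
    simp only [stA, hs, Option.bind_some, stp, ho, if_neg hx]
  · rename_i ho
    split_ifs at h with hx
    · right; left
      simp at h
      exact ⟨ho, hx, h.symm⟩
    · right; right
      refine ⟨ho, by omega, ?_, h⟩
      simp only [stA, hs, Option.bind_some, stp, ho, if_neg hx]

theorem trace_def (g : Grid) (f x y : ℕ) (d : Dir) (e : ℕ) (h : traceAux g f x y d = some e) :
    ∃ a, outDir (g.tile x y) d = some a := by
  cases f with
  | zero => simp [traceAux] at h
  | succ f =>
    unfold traceAux at h
    split at h
    · simp at h
    · exact ⟨_, by assumption⟩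
    · exact ⟨_, by assumption⟩

theorem forward (g : Grid) (hnb : ∀ i j, InGrid g i j → g.tile i j ≠ Tile.bump) (p q : ℕ)
    (hp : 1 ≤ p ∧ p ≤ g.n) (hq : 1 ≤ q ∧ q ≤ g.n) (f : ℕ) : ∀ t t' x y d x' y' d' e e',
    stA g p t = some (x, y, d) → stA g q t' = some (x', y', d') → y + x' = y' + x → x' < x →
    traceAux g f x y d = some e → traceAux g f x' y' d' = some e' →
    e' < e ∨ ∃ z : ℕ × ℕ, CC g p q z ∧ z.1 + y < z.2 + x := by
  induction f with
  | zero => intro t t' x y d x' y' d' e e' _ _ _ _ h; simp [traceAux] at h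
  | succ f ih =>
    intro t t' x y d x' y' d' e e' h1 h2 h3 h4 h5 h6
    have b1 := stA_bd g p hp.1 hp.2 _ _ _ _ h1
    have b2 := stA_bd g q hq.1 hq.2 _ _ _ _ h2
    have le6 := (trace_mono g _ _ _ _ _ h6).2
    rcases trace_step g p _ _ _ _ _ _ h1 h5 with ⟨a1, a2, a3, a4⟩ | ⟨a1, a2, a3⟩ | ⟨a1, a2, a3, a4⟩
    · rcases trace_step g q _ _ _ _ _ _ h2 h6 with ⟨c1, c2, c3, c4⟩ | ⟨c1, c2, c3⟩ | ⟨c1, c2, c3, c4⟩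
      · rcases ih _ _ _ _ _ _ _ _ e e' a3 c3 (by omega) (by omega) a4 c4 with h | ⟨z, hz, hz'⟩
        · exact Or.inl h
        · exact Or.inr ⟨z, hz, by omega⟩
      · omega
      · rcases Nat.lt_or_ge x' (x-1) with hx | hx
        · rcases ih _ _ _ _ _ _ _ _ e e' a3 c3 (by omega) (by omega) a4 c4 with h | ⟨z, hz, hz'⟩
          · exact Or.inl h
          · exact Or.inr ⟨z, hz, by omega⟩
        · right
          have ee : x' = x - 1 := by omega
          have ee' : y' + 1 = y := by omega
          rw [ee, ee'] at c3 c4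
          refine ⟨(x-1, y), ⟨?_, ⟨_, _, a3⟩, ⟨_, _, c3⟩⟩, by simp only; omega⟩
          obtain ⟨u, hu⟩ := trace_def _ _ _ _ _ _ a4
          obtain ⟨v, hv⟩ := trace_def _ _ _ _ _ _ c4
          exact in_two _ u v (hnb _ _ ⟨by omega, by omega, by omega, by omega⟩) hu hv
    · left; omega
    · rcases trace_step g q _ _ _ _ _ _ h2 h6 with ⟨c1, c2, c3, c4⟩ | ⟨c1, c2, c3⟩ | ⟨c1, c2, c3, c4⟩
      · rcases ih _ _ _ _ _ _ _ _ e e' a3 c3 (by omega) (by omega) a4 c4 with h | ⟨z, hz, hz'⟩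
        · exact Or.inl h
        · exact Or.inr ⟨z, hz, by omega⟩
      · omega
      · rcases ih _ _ _ _ _ _ _ _ e e' a3 c3 (by omega) (by omega) a4 c4 with h | ⟨z, hz, hz'⟩
        · exact Or.inl h
        · exact Or.inr ⟨z, hz, by omega⟩

theorem stA_north (g : Grid) (c t x y : ℕ) (d : Dir) (hx : 1 ≤ x) (h : stA g c t = some (x+1, y, d))
    (ho : outDir (g.tile (x+1) y) d = some Dir.north) :
    stA g c (t+1) = some (x, y, Dir.north) := by
  have : ¬ (x + 1 ≤ 1) := by omega
  simp only [stA, h, Option.bind_some, stp, ho, if_neg this, Nat.add_sub_cancel]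

theorem stA_east (g : Grid) (c t x y : ℕ) (d : Dir) (hy : y < g.n) (h : stA g c t = some (x, y, d))
    (ho : outDir (g.tile x y) d = some Dir.east) :
    stA g c (t+1) = some (x, y+1, Dir.east) := by
  have : ¬ (g.n ≤ y) := by omega
  simp only [stA, h, Option.bind_some, stp, ho, if_neg this]

theorem stA_exists (g : Grid) (hB : IsBPD g) (m : ℕ) : ∀ x y, InGrid g x y → g.n - x + y ≤ m →
    (hasS (g.tile x y) = true → ∃ c t, 1 ≤ c ∧ c ≤ g.n ∧ stA g c t = some (x, y, Dir.north)) ∧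
    (hasW (g.tile x y) = true → ∃ c t, 1 ≤ c ∧ c ≤ g.n ∧ stA g c t = some (x, y, Dir.east)) := by
  obtain ⟨b1, b2, b3, b4, b5, b6, b7, b8, b9, b10⟩ := hB
  induction m with
  | zero => intro x y ⟨h1, h2, h3, h4⟩ hm; omega
  | succ m ih =>
    intro x y ⟨h1, h2, h3, h4⟩ hm
    constructor
    · intro hS
      rcases Nat.lt_or_ge x g.n with hx | hx
      · have hN := b4 x y h1 hx h3 h4
        rw [hS] at hN
        have hG : InGrid g (x+1) y := ⟨by omega, by omega, h3, h4⟩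
        obtain ⟨i1, i2⟩ := ih (x+1) y hG (by omega)
        have hb := b3 (x+1) y hG
        cases hT : g.tile (x+1) y <;> simp [hT, hasN] at hN hb
        · obtain ⟨c, t, c1, c2, c3⟩ := i1 (by simp [hT, hasS])
          exact ⟨c, t+1, c1, c2, stA_north g c t x y _ h1 c3 (by simp [hT, outDir])⟩
        · obtain ⟨c, t, c1, c2, c3⟩ := i2 (by simp [hT, hasW])
          exact ⟨c, t+1, c1, c2, stA_north g c t x y _ h1 c3 (by simp [hT, outDir])⟩
        · obtain ⟨c, t, c1, c2, c3⟩ := i1 (by simp [hT, hasS])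
          exact ⟨c, t+1, c1, c2, stA_north g c t x y _ h1 c3 (by simp [hT, outDir])⟩
      · have : x = g.n := by omega
        subst this
        exact ⟨y, 0, h3, h4, rfl⟩
    · intro hW
      rcases Nat.eq_or_lt_of_le h3 with hy | hy
      · rw [← hy, b8 x h1 h2] at hW; simp at hW
      · obtain ⟨y, rfl⟩ : ∃ y', y = y' + 1 := ⟨y - 1, by omega⟩
        have hE := b5 x y h1 h2 (by omega) (by omega)
        rw [hW] at hE
        have hG : InGrid g x y := ⟨by omega, by omega, by omega, by omega⟩
        obtain ⟨i1, i2⟩ := ih x y hG (by omega)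
        have hb := b3 x y hG
        cases hT : g.tile x y <;> simp [hT, hasE] at hE hb
        · obtain ⟨c, t, c1, c2, c3⟩ := i2 (by simp [hT, hasW])
          exact ⟨c, t+1, c1, c2, stA_east g c t x y _ (by omega) c3 (by simp [hT, outDir])⟩
        · obtain ⟨c, t, c1, c2, c3⟩ := i1 (by simp [hT, hasS])
          exact ⟨c, t+1, c1, c2, stA_east g c t x y _ (by omega) c3 (by simp [hT, outDir])⟩
        · obtain ⟨c, t, c1, c2, c3⟩ := i2 (by simp [hT, hasW])
          exact ⟨c, t+1, c1, c2, stA_east g c t x y _ (by omega) c3 (by simp [hT, outDir])⟩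



structure Bot (g : Grid) (w : Perm') (k n : ℕ) : Prop where
  N : ∀ x y, k < x → x ≤ n → 1 ≤ y → y ≤ n → (hasN (g.tile x y) = true ↔ w.symm y < x)
  S : ∀ x y, k < x → x ≤ n → 1 ≤ y → y ≤ n → (hasS (g.tile x y) = true ↔ w.symm y ≤ x)
  E : ∀ x y, k < x → x ≤ n → 1 ≤ y → y ≤ n → (hasE (g.tile x y) = true ↔ w x ≤ y)
  W : ∀ x y, k < x → x ≤ n → 1 ≤ y → y ≤ n → (hasW (g.tile x y) = true ↔ w x < y)
  nb : ∀ x y, k < x → x ≤ n → 1 ≤ y → y ≤ n → g.tile x y ≠ Tile.bump ∧ g.tile x y ≠ Tile.nw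

theorem GP.mem {w : Perm'} {k n : ℕ} (h : GP w k n) (x : ℕ) (h1 : 1 ≤ x) (h2 : x ≤ n) :
    1 ≤ w x ∧ w x ≤ n := by
  constructor
  · rcases Nat.eq_zero_or_pos (w x) with h0 | h0
    · rw [← h.w0] at h0; have := w.injective h0; omega
    · exact h0
  · by_contra hh
    have := h.fx (w x) (by omega)
    have := w.injective this
    omega

theorem GP.memS {w : Perm'} {k n : ℕ} (h : GP w k n) (x : ℕ) (h1 : 1 ≤ x) (h2 : x ≤ n) :
    1 ≤ w.symm x ∧ w.symm x ≤ n := by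
  have e : w (w.symm x) = x := by simp
  constructor
  · rcases Nat.eq_zero_or_pos (w.symm x) with h0 | h0
    · rw [h0, h.w0] at e; omega
    · exact h0
  · by_contra hh
    have := h.fx (w.symm x) (by omega)
    omega

theorem trace_row (g : Grid) (i e : ℕ) (f : ℕ) : ∀ y,
    (∀ y', y ≤ y' → y' ≤ g.n → g.tile i y' = Tile.horiz ∨ g.tile i y' = Tile.cross) → y ≤ g.n →
    traceAux g f i y Dir.east = some e → e = i := by
  induction f with
  | zero => intro y _ _ h; simp [traceAux] at h
  | succ f ih =>
    intro y hy hyn h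
    have ho : outDir (g.tile i y) Dir.east = some Dir.east := by
      rcases hy y le_rfl hyn with h | h <;> simp [h, outDir]
    simp only [traceAux, ho] at h
    split_ifs at h with hx
    · simp at h; exact h.symm
    · exact ih (y+1) (fun y' h1 h2 => hy y' (by omega) h2) (by omega) h

theorem tl_se (T : Tile) (h1 : T ≠ Tile.bump) (h2 : ¬ (T = Tile.horiz ∨ T = Tile.cross))
    (h3 : hasE T = true) : T = Tile.se := by
  cases T <;> simp_all [hasE]

theorem tl_WE (T : Tile) (h1 : T ≠ Tile.bump) (h2 : T ≠ Tile.nw)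
    (h3 : hasW T = true) : hasE T = true := by
  cases T <;> simp_all [hasE, hasW]

theorem tl_NS (T : Tile) (h1 : hasW T = false) (h2 : hasE T = false) : hasN T = hasS T := by
  cases T <;> simp_all [hasE, hasW, hasN, hasS]

theorem tl_N (T : Tile) (h1 : T ≠ Tile.bump) (h2 : T ≠ Tile.nw) (h3 : hasN T = true) :
    outDir T Dir.north = some Dir.north := by
  cases T <;> simp_all [hasN, outDir]

theorem bot_row (g : Grid) (w : Perm') (k n : ℕ) (hB : IsBPD g) (hgn : g.n = n) (hG : GP w k n)
    (i : ℕ) (hk : k < i) (hi : i ≤ n)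
    (hS : ∀ j, 1 ≤ j → j ≤ n → (hasS (g.tile i j) = true ↔ w.symm j ≤ i))
    (hT : ∀ j, 1 ≤ j → j ≤ n → w.symm j ≤ i → ∃ f, traceAux g f i j Dir.north = some (w.symm j)) :
    (∀ j, 1 ≤ j → j ≤ n → (hasN (g.tile i j) = true ↔ w.symm j < i) ∧
      (hasE (g.tile i j) = true ↔ w i ≤ j) ∧ (hasW (g.tile i j) = true ↔ w i < j) ∧
      g.tile i j ≠ Tile.bump ∧ g.tile i j ≠ Tile.nw) := by
  obtain ⟨b1, b2, b3, b4, b5, b6, b7, b8, b9, b10⟩ := hB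
  have hk1 := hG.k1
  have hnb : ∀ j, 1 ≤ j → j ≤ n → g.tile i j ≠ Tile.bump :=
    fun j h1 h2 => b3 i j ⟨by omega, by omega, h1, by omega⟩
  -- rightmost non straight tile
  obtain ⟨m, hm1, hmn, hmt, hmr⟩ : ∃ m, 1 ≤ m ∧ m ≤ n ∧
      ¬ (g.tile i m = Tile.horiz ∨ g.tile i m = Tile.cross) ∧
      ∀ y, m < y → y ≤ n → g.tile i y = Tile.horiz ∨ g.tile i y = Tile.cross := by
    have h1 : ¬ (g.tile i 1 = Tile.horiz ∨ g.tile i 1 = Tile.cross) := by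
      have := b8 i (by omega) (by omega)
      rintro (h | h) <;> simp [h, hasW] at this
    let P : ℕ → Prop := fun m => 1 ≤ m ∧ ¬ (g.tile i m = Tile.horiz ∨ g.tile i m = Tile.cross)
    classical
    have hP1 : P 1 := ⟨le_rfl, h1⟩
    refine ⟨Nat.findGreatest P n, ?_, Nat.findGreatest_le n, ?_, ?_⟩
    · exact (Nat.findGreatest_spec (P := P) (by omega : 1 ≤ n) hP1).1
    · exact (Nat.findGreatest_spec (P := P) (by omega : 1 ≤ n) hP1).2
    · intro y hy hyn
      have := Nat.findGreatest_is_greatest hy hyn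
      by_contra hh
      exact this ⟨by omega, hh⟩
  have hmE : hasE (g.tile i m) = true := by
    rcases Nat.eq_or_lt_of_le hmn with h | h
    · rw [h, ← hgn]; exact b9 i (by omega) (by omega)
    · rw [b5 i m (by omega) (by omega) hm1 (by omega)]
      rcases hmr (m+1) (by omega) (by omega) with h | h <;> simp [h, hasW]
  have hse : g.tile i m = Tile.se := by
    exact tl_se _ (hnb m hm1 hmn) hmt hmE
  have hwm : w.symm m = i := by
    have hs : w.symm m ≤ i := (hS m hm1 hmn).1 (by simp [hse, hasS])
    obtain ⟨f, hf⟩ := hT m hm1 hmn hs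
    cases f with
    | zero => simp [traceAux] at hf
    | succ f =>
      have ho : outDir (g.tile i m) Dir.north = some Dir.east := by simp [hse, outDir]
      simp only [traceAux, ho] at hf
      split_ifs at hf with hx
      · simp at hf; exact hf.symm
      · exact trace_row g i _ f (m+1) (fun y h1 h2 => hmr y (by omega) (by omega)) (by omega) hf
  have hwi : w i = m := by rw [← hwm]; simp
  have hnw : ∀ j, 1 ≤ j → j ≤ n → g.tile i j ≠ Tile.nw := by
    intro j h1 h2 h
    have h3 : ¬ (w.symm j ≤ i) := by rw [← hS j h1 h2]; simp [h, hasS]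
    have h4 := hG.inc2 i (w.symm j) hk (by omega)
    simp [hwi] at h4
    rcases hmr j h4 h2 with h5 | h5 <;> simp [h5] at h
  have hWE : ∀ j, 1 ≤ j → j ≤ n → hasW (g.tile i j) = true → hasE (g.tile i j) = true := by
    intro j h1 h2 h
    exact tl_WE _ (hnb j h1 h2) (hnw j h1 h2) h
  have hWm : ∀ d, d < m → hasW (g.tile i (m - d)) = false := by
    intro d
    induction d with
    | zero => intro _; simp [hse, hasW]
    | succ d ih =>
      intro hd
      have h1 := ih (by omega)
      by_contra hh
      have h2 := hWE (m - (d+1)) (by omega) (by omega) (by simpa using hh)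
      rw [b5 i _ (by omega) (by omega) (by omega) (by omega),
        show m - (d + 1) + 1 = m - d by omega, h1] at h2
      simp at h2
  have hWl : ∀ j, 1 ≤ j → j ≤ m → hasW (g.tile i j) = false := by
    intro j h1 h2
    have := hWm (m - j) (by omega)
    rwa [show m - (m - j) = j by omega] at this
  intro j h1 h2
  have hs := hS j h1 h2
  have a1 := hnb j h1 h2
  have a2 := hnw j h1 h2
  rcases lt_trichotomy j m with h | h | h
  · have hw := hWl j h1 h.le
    have he : hasE (g.tile i j) = false := by
      rw [b5 i _ (by omega) (by omega) (by omega) (by omega)]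
      exact hWl (j+1) (by omega) (by omega)
    have hNS : hasN (g.tile i j) = hasS (g.tile i j) := tl_NS _ hw he
    have hne : w.symm j ≠ i := by
      intro hh; rw [← hh] at hwi; simp at hwi; omega
    refine ⟨?_, ?_, ?_, a1, a2⟩
    · rw [hNS, hs]; omega
    · rw [he, hwi]; simp; omega
    · rw [hw, hwi]; simp; omega
  · subst h
    rw [hwi, hwm, hse]
    simp [hasN, hasE, hasW]
  · have hne : w.symm j ≠ i := by
      intro hh; rw [← hh] at hwi; simp at hwi; omega
    have hNS : hasN (g.tile i j) = hasS (g.tile i j) := by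
      rcases hmr j h h2 with h | h <;> simp [h, hasN, hasS]
    refine ⟨?_, ?_, ?_, a1, a2⟩
    · rw [hNS, hs]; omega
    · rw [hwi]; rcases hmr j h h2 with h | h <;> simp [h, hasE] <;> omega
    · rw [hwi]; rcases hmr j h h2 with h | h <;> simp [h, hasW] <;> omega

theorem bot_S (g : Grid) (w : Perm') (k n : ℕ) (hB : MemBPD w g) (hgn : g.n = n) (hG : GP w k n)
    (d : ℕ) : ∀ i, i + d = n → k ≤ i →
    (∀ j, 1 ≤ j → j ≤ n → (hasS (g.tile i j) = true ↔ w.symm j ≤ i)) ∧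
    (∀ j, 1 ≤ j → j ≤ n → w.symm j ≤ i → ∃ f, traceAux g f i j Dir.north = some (w.symm j)) := by
  obtain ⟨hB, b11, b12, b13⟩ := hB
  have hBB := hB
  obtain ⟨b1, b2, b3, b4, b5, b6, b7, b8, b9, b10⟩ := hB
  have hk1 := hG.k1
  induction d with
  | zero =>
    intro i hi hk
    have : i = n := by omega
    subst this
    constructor
    · intro j h1 h2
      have e1 := (hG.memS j h1 h2).2
      have e2 := b7 j h1 (by omega)
      rw [hgn] at e2
      simp [e1, e2]
    · intro j h1 h2 _
      have := b13 j h1 (by omega)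
      unfold exitRow at this
      rw [hgn] at this
      exact ⟨_, this⟩
  | succ d ih =>
    intro i hi hk
    obtain ⟨i1, i2⟩ := ih (i+1) (by omega) (by omega)
    have hrow := bot_row g w k n hBB hgn hG (i+1) (by omega) (by omega) i1 i2
    constructor
    · intro j h1 h2
      rw [b4 i j (by omega) (by omega) h1 (by omega), (hrow j h1 h2).1]
      omega
    · intro j h1 h2 h3
      obtain ⟨f, hf⟩ := i2 j h1 h2 (by omega)
      obtain ⟨r1, r2, r3, r4, r5⟩ := hrow j h1 h2
      have hN := r1.2 (by omega)
      have ho : outDir (g.tile (i+1) j) Dir.north = some Dir.north := tl_N _ r4 r5 hN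
      cases f with
      | zero => simp [traceAux] at hf
      | succ f =>
        have : ¬ (i + 1 ≤ 1) := by omega
        simp only [traceAux, ho, if_neg this, Nat.add_sub_cancel] at hf
        exact ⟨f, hf⟩

theorem bot_of (g : Grid) (w : Perm') (k n : ℕ) (hB : MemBPD w g) (hgn : g.n = n) (hG : GP w k n) :
    Bot g w k n := by
  have key : ∀ x, k < x → x ≤ n → _ := fun x h1 h2 =>
    bot_S g w k n hB hgn hG (n - x) x (by omega) (by omega)
  have key2 : ∀ x, k < x → x ≤ n → _ := fun x h1 h2 =>
    bot_row g w k n hB.1 hgn hG x h1 h2 (key x h1 h2).1 (key x h1 h2).2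
  exact ⟨fun x y h1 h2 h3 h4 => (key2 x h1 h2 y h3 h4).1,
    fun x y h1 h2 h3 h4 => (key x h1 h2).1 y h3 h4,
    fun x y h1 h2 h3 h4 => (key2 x h1 h2 y h3 h4).2.1,
    fun x y h1 h2 h3 h4 => (key2 x h1 h2 y h3 h4).2.2.1,
    fun x y h1 h2 h3 h4 => (key2 x h1 h2 y h3 h4).2.2.2⟩

theorem exit_at (g : Grid) (w : Perm') (hB : MemBPD w g) (c t x y : ℕ) (d : Dir)
    (h1 : 1 ≤ c) (h2 : c ≤ g.n) (h : stA g c t = some (x, y, d)) :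
    ∃ f, ∀ s, traceAux g (f + s) x y d = some (w.symm c) := by
  have hb := stA_bd g c h1 h2 t x y d h
  have h3 := (stA_tail g c t x y d h (2 * g.n + 2) (by omega)).1
  have h4 := hB.2.2.2 c h1 h2
  unfold exitRow at h4
  rw [h3] at h4
  exact ⟨_, fun s => trace_mono' g _ s _ _ _ _ h4⟩

theorem no_cross (g : Grid) (w : Perm') (k n : ℕ) (hB : MemBPD w g) (hgn : g.n = n)
    (hG : GP w k n) (i j : ℕ) (hi1 : 1 ≤ i) (hik : i ≤ k) (hj1 : 1 ≤ j) (hjn : j ≤ n) :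
    g.tile i j ≠ Tile.cross := by
  intro hc
  have hkn := hG.kn
  have hB1 := hB.1
  have hred := hB.1.2.2.2.2.2.2.2.2.2
  have hnb := hB.1.2.2.1
  have hW1 := hB.1.2.2.2.2.2.2.2.1
  have hIn : InGrid g i j := ⟨hi1, by omega, hj1, by omega⟩
  obtain ⟨s1, s2⟩ := stA_exists g hB1 _ i j hIn le_rfl
  obtain ⟨q, tq, q1, q2, q3⟩ := s1 (by simp [hc, hasS])
  obtain ⟨p, tp, p1, p2, p3⟩ := s2 (by simp [hc, hasW])
  have hpq : p ≠ q := by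
    rintro rfl
    have e1 := stA_bd g p p1 p2 _ _ _ _ p3
    have e2 := stA_bd g p p1 p2 _ _ _ _ q3
    have : tp = tq := by omega
    rw [this, q3] at p3
    simp at p3
  have hsub := hred p q p1 p2 q1 q2 hpq
  have huniq : ∀ z : ℕ × ℕ, CC g p q z → z = (i, j) := by
    intro z ⟨z1, ⟨t, d, z2⟩, ⟨t', d', z3⟩⟩
    apply hsub
    · exact ⟨z1, stA_passes g p t z.1 z.2 d p1 p2 z2, stA_passes g q t' z.1 z.2 d' q1 q2 z3⟩
    · exact ⟨hc, stA_passes g p _ _ _ _ p1 p2 p3, stA_passes g q _ _ _ _ q1 q2 q3⟩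
  have hlt : p < q := by
    rcases stA_inv g q _ _ _ _ q3 with ⟨_, e1, e2, e3⟩ | ⟨_, s', D', e1, e2, e3, e4⟩ |
        ⟨hd, _⟩
    · omega
    · rcases stA_inv g p _ _ _ _ p3 with ⟨hd, _⟩ | ⟨hd, _⟩ |
        ⟨_, s, D, v, f1, f2, f3, f4, f5⟩
      · simp at hd
      · simp at hd
      · rcases backward g hnb p q ⟨p1, p2⟩ ⟨q1, q2⟩ _ _ _ _ _ _ _ _ f3 e2 (by omega) (by omega)
          with h | ⟨z, hz, hz'⟩
        · exact h
        · have := huniq z hz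
          subst this
          simp only at hz'
          omega
    · simp at hd
  obtain ⟨fp, hfp⟩ := exit_at g w hB p _ _ _ _ p1 p2 p3
  obtain ⟨fq, hfq⟩ := exit_at g w hB q _ _ _ _ q1 q2 q3
  have tp' : traceAux g ((fp + fq) + 1) i j Dir.east = some (w.symm p) := by
    have := hfp (fq + 1); rwa [← add_assoc] at this
  have tq' : traceAux g ((fp + fq) + 1) i j Dir.north = some (w.symm q) := by
    have := hfq (fp + 1); rwa [show fq + (fp + 1) = fp + fq + 1 by omega] at this
  have lep := (trace_mono g _ _ _ _ _ tp').2
  have hex : w.symm q < w.symm p := by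
    rcases trace_step g q _ _ _ _ _ _ q3 tq' with ⟨c1, c2, c3, c4⟩ | ⟨c1, c2, c3⟩ | ⟨c1, c2, c3, c4⟩
    · have leq := (trace_mono g _ _ _ _ _ c4).2
      rcases trace_step g p _ _ _ _ _ _ p3 tp' with ⟨a1, a2, a3, a4⟩ | ⟨a1, a2, a3⟩ | ⟨a1, a2, a3, a4⟩
      · simp [hc, outDir] at a1
      · omega
      · rcases forward g hnb p q ⟨p1, p2⟩ ⟨q1, q2⟩ _ _ _ _ _ _ _ _ _ _ _ a3 c3 (by omega) (by omega)
          a4 c4 with h | ⟨z, hz, hz'⟩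
        · exact h
        · have := huniq z hz
          subst this
          simp only at hz'
          omega
    · simp [hc, outDir] at c1
    · simp [hc, outDir] at c1
  have := hG.inc1 (w.symm q) (w.symm p) (hG.memS q q1 (by omega)).1 hex (by omega)
  simp at this
  omega



def HQ (R : ℕ → ℕ → ℕ) (w : Perm') (k : ℕ) : Prop := ∀ r j, r < k → (r < R k j ↔ j < w (k - r))

/-- number of vertical edges at the bottom of the first `j` tiles of row `i` -/
def cS (g : Grid) (i : ℕ) : ℕ → ℕ
  | 0 => 0
  | j + 1 => cS g i j + (hasS (g.tile i (j+1))).toNat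

theorem tl_cons (T : Tile) : (hasN T).toNat + (hasE T).toNat = (hasS T).toNat + (hasW T).toNat := by
  cases T <;> rfl

theorem cS_zero (g : Grid) (hB : IsBPD g) (j : ℕ) : cS g 0 j = 0 := by
  induction j with
  | zero => rfl
  | succ j ih =>
    have : g.tile 0 (j+1) = Tile.horiz := hB.2.1 _ _ (by unfold InGrid; omega)
    simp [cS, ih, this, hasS]

theorem cS_N (g : Grid) (hB : IsBPD g) (i j : ℕ) (hi : i < g.n) (hj : j < g.n) :
    hasS (g.tile i (j+1)) = hasN (g.tile (i+1) (j+1)) := by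
  rcases Nat.eq_zero_or_pos i with h | h
  · subst h
    have : g.tile 0 (j+1) = Tile.horiz := hB.2.1 _ _ (by unfold InGrid; omega)
    rw [this, hB.2.2.2.2.2.1 (j+1) (by omega) (by omega)]
    rfl
  · exact hB.2.2.2.1 i (j+1) h hi (by omega) (by omega)

theorem cS_step (g : Grid) (hB : IsBPD g) (i j : ℕ) (hi : i < g.n) (hj : j < g.n) :
    cS g (i+1) (j+1) = cS g i (j+1) + (hasE (g.tile (i+1) (j+1))).toNat := by
  induction j with
  | zero =>
    have h1 := hB.2.2.2.2.2.2.2.1 (i+1) (by omega) (by omega)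
    have h2 := tl_cons (g.tile (i+1) 1)
    have h3 := cS_N g hB i 0 hi hj
    simp only [cS]
    simp only [zero_add] at h3 ⊢
    rw [h3]
    rw [h1] at h2
    simp at h2
    omega
  | succ j ih =>
    have h1 := hB.2.2.2.2.1 (i+1) (j+1) (by omega) (by omega) (by omega) (by omega)
    have h2 := tl_cons (g.tile (i+1) (j+1+1))
    have h3 := cS_N g hB i (j+1) hi hj
    have h4 := ih (by omega)
    have e1 : cS g (i+1) (j+1+1) = cS g (i+1) (j+1) + (hasS (g.tile (i+1) (j+1+1))).toNat := rfl
    have e2 : cS g i (j+1+1) = cS g i (j+1) + (hasS (g.tile i (j+1+1))).toNat := rfl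
    rw [e1, e2, h4, h3, h1]
    omega

theorem cS_le (g : Grid) (hB : IsBPD g) (i j : ℕ) (hi : i ≤ g.n) (hj : j ≤ g.n) :
    cS g i j ≤ i := by
  rcases j with _ | j
  · simp [cS]
  induction i with
  | zero => simp [cS_zero g hB]
  | succ i ih =>
    rw [cS_step g hB i j (by omega) (by omega)]
    have := Bool.toNat_le1 (hasE (g.tile (i+1) (j+1)))
    have := ih (by omega)
    omega

theorem cS_n (g : Grid) (hB : IsBPD g) (i j : ℕ) (hi : i ≤ g.n) (hj : g.n ≤ j) :
    cS g i j = i := by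
  induction j with
  | zero => have := hB.1; omega
  | succ j ih =>
    rcases Nat.lt_or_ge j g.n with h | h
    · have hj' : j + 1 = g.n := by omega
      clear ih
      induction i with
      | zero => simp [cS_zero g hB]
      | succ i ih2 =>
        rw [cS_step g hB i j (by omega) (by omega), ih2 (by omega), hj',
          hB.2.2.2.2.2.2.2.2.1 (i+1) (by omega) (by omega)]
        rfl
    · have : g.tile i (j+1) = Tile.horiz := hB.2.1 _ _ (by unfold InGrid; omega)
      simp [cS, ih h, this, hasS]

theorem top_of (g : Grid) (w : Perm') (k n : ℕ) (hM : MemBPD w g) (hgn : g.n = n) (hG : GP w k n) :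
    Top g (fun i j => i - cS g i j) k n := by
  have hB := hM.1
  have hkn := hG.kn
  refine ⟨hG.kn, hgn, hB.2.1, by simp, by simp [cS], ?_, ?_, ?_, ?_, ?_, ?_⟩
  · intro i j hi hj
    rw [cS_n g hB i j (by omega) (by omega)]; omega
  · intro i j hi hj
    exact ⟨no_cross g w k n hM hgn hG _ _ (by omega) (by omega) (by omega) (by omega),
      hB.2.2.1 _ _ ⟨by omega, by omega, by omega, by omega⟩⟩
  · intro i j hi hj
    rw [← cS_N g hB i j (by omega) (by omega)]
    have h2 := cS_le g hB i (j+1) (by omega) (by omega)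
    rw [cS] at h2 ⊢
    omega
  · intro i j hi hj
    have h2 := cS_le g hB (i+1) (j+1) (by omega) (by omega)
    rw [cS] at h2 ⊢
    omega
  · intro i j hi hj
    rcases j with _ | j
    · have h1 := hB.2.2.2.2.2.2.2.1 (i+1) (by omega) (by omega)
      simp [cS, h1]
    · have h1 := hB.2.2.2.2.1 (i+1) (j+1) (by omega) (by omega) (by omega) (by omega)
      rw [← h1]
      have h3 := cS_step g hB i j (by omega) (by omega)
      have h2 := cS_le g hB (i+1) (j+1) (by omega) (by omega)
      have h4 := cS_le g hB i (j+1) (by omega) (by omega)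
      omega
  · intro i j hi hj
    have h3 := cS_step g hB i j (by omega) (by omega)
    have h2 := cS_le g hB (i+1) (j+1) (by omega) (by omega)
    have h4 := cS_le g hB i (j+1) (by omega) (by omega)
    omega

theorem hq_of (g : Grid) (w : Perm') (k n : ℕ) (hM : MemBPD w g) (hgn : g.n = n) (hG : GP w k n) :
    HQ (fun i j => i - cS g i j) w k := by
  have hkn := hG.kn
  have hk1 := hG.k1
  have hT := top_of g w k n hM hgn hG
  have hS := (bot_S g w k n hM hgn hG (n - k) k (by omega) le_rfl).1
  intro r j
  simp only
  induction j generalizing r with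
  | zero =>
    intro hr
    have := (hG.mem (k - r) (by omega) (by omega)).1
    simp [cS]; omega
  | succ j ih =>
    intro hr
    rcases Nat.lt_or_ge j n with hj | hj
    · have h2 := cS_le g hM.1 k (j+1) (by omega) (by omega)
      have hs := hS (j+1) (by omega) (by omega)
      rw [cS] at h2 ⊢
      have hm := hG.memS (j+1) (by omega) (by omega)
      have hwm : w (w.symm (j+1)) = j+1 := by simp
      generalize w.symm (j+1) = m at hs hm hwm
      by_cases h : m ≤ k
      · rw [hs.2 h] at h2 ⊢
        simp only [Bool.toNat_true] at h2 ⊢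
        have i1 := (ih (k - m) (by omega)).2 (by rw [show k - (k - m) = m by omega]; omega)
        have i2 : ¬ (k - m + 1 < k - cS g k j) := by
          intro hh
          have hh' := (ih (k - m + 1) (by omega)).1 hh
          have := hG.inc1 (k - (k - m + 1)) m (by omega) (by omega) h
          omega
        constructor
        · intro h3
          have := hG.inc1 m (k - r) (by omega) (by omega) (by omega)
          omega
        · intro h3
          have : ¬ (k - r ≤ m) := by
            intro h4
            rcases Nat.eq_or_lt_of_le h4 with h5 | h5
            · rw [h5] at h3; omega
            · have := hG.inc1 (k - r) m (by omega) h5 h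
              omega
          omega
      · have : hasS (g.tile k (j+1)) = false := by
          by_contra hh
          exact h (hs.1 (by simpa using hh))
        rw [this]
        simp only [Bool.toNat_false, add_zero]
        rw [ih r hr]
        have : w (k - r) ≠ j + 1 := by
          rw [← hwm]; intro hh; have := w.injective hh; omega
        omega
    · rw [cS_n g hM.1 k (j+1) (by omega) (by omega)]
      have := (hG.mem (k - r) (by omega) (by omega)).2
      omega

theorem gp_of (w : Perm') (n : ℕ) (hG : Grassmannian w) (hl : 1 ≤ plen w)
    (hfx : ∀ k, n < k → w k = k) : ∃ k, GP w k n ∧ w (k+1) < w k := by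
  have hw0 := hG.1.1
  have hne : w ≠ 1 := by
    rintro rfl
    have : plen 1 ≤ 0 := Nat.sInf_le ⟨[], ⟨by simp, by simp [wordProd]⟩, rfl⟩
    omega
  obtain ⟨k, hk⟩ : ∃ k, Descent w k := by
    by_contra hh
    push Not at hh
    have hmono : StrictMono w := by
      apply strictMono_nat_of_lt_succ
      intro m
      have hm : w m ≠ w (m+1) := fun h => by have := w.injective h; omega
      rcases Nat.eq_zero_or_pos m with h | h
      · subst h; rw [hw0] at hm ⊢; omega
      · have := hh m
        unfold Descent at this
        by_contra h2
        exact this ⟨h, by omega⟩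
    apply hne
    have hmono' : StrictMono w.symm := by
      intro a b hab
      by_contra h2
      have := hmono.monotone (not_lt.mp h2)
      simp at this; omega
    ext m
    have h1 := hmono.le_apply (x := m)
    have h2 := hmono'.le_apply (x := w m)
    simp at h2 ⊢
    omega
  have huniq : ∀ m, 1 ≤ m → m ≠ k → w m < w (m+1) := by
    intro m h1 h2
    by_contra hh
    have hm : w m ≠ w (m+1) := fun h => by have := w.injective h; omega
    exact h2 (hG.2 (show m ∈ {k | Descent w k} from ⟨h1, by omega⟩) hk)
  have hkn : k < n := by
    by_contra hh
    have h1 := hk.2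
    rw [hfx (k+1) (by omega)] at h1
    have := hfx (w k) (by omega)
    have := w.injective this
    omega
  refine ⟨k, ⟨hk.1, hkn, hw0, hfx, ?_, ?_⟩, hk.2⟩
  · intro i j h1 h2 h3
    induction j with
    | zero => omega
    | succ j ih =>
      have := huniq j (by omega) (by omega)
      rcases Nat.lt_or_ge i j with h | h
      · have := ih h (by omega); omega
      · have : i = j := by omega
        subst this; assumption
  · intro i j h1 h2
    have hk1 := hk.1
    induction j with
    | zero => omega
    | succ j ih =>
      have := huniq j (by omega) (by omega)
      rcases Nat.lt_or_ge i j with h | h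
      · have := ih h; omega
      · have : i = j := by omega
        subst this; assumption



structure Mt (g : Grid) (n : ℕ) : Prop where
  gn : g.n = n
  s : ∀ x y, 1 ≤ x → x < n → 1 ≤ y → y ≤ n → hasS (g.tile x y) = hasN (g.tile (x+1) y)
  e : ∀ x y, 1 ≤ x → x ≤ n → 1 ≤ y → y < n → hasE (g.tile x y) = hasW (g.tile x (y+1))
  l : ∀ x, 1 ≤ x → x ≤ n → hasW (g.tile x 1) = false
  nb : ∀ x y, 1 ≤ x → x ≤ n → 1 ≤ y → y ≤ n → g.tile x y ≠ Tile.bump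

theorem toNat_inj (a b : Bool) (h : a.toNat = b.toNat) : a = b := by
  cases a <;> cases b <;> simp_all

/-- in the bottom row of the top part, the pipes are in the columns `w 1, …, w k` -/
theorem hq_S {g : Grid} {R : ℕ → ℕ → ℕ} {w : Perm'} {k n : ℕ} (hG : GP w k n) (hT : Top g R k n)
    (hq : HQ R w k) (y : ℕ) (hy : y < n) :
    hasS (g.tile k (y+1)) = true ↔ w.symm (y+1) ≤ k := by
  have hk1 := hG.k1
  have e := hT.eS (k-1) y (by omega) hy
  rw [show k - 1 + 1 = k by omega] at e
  have hm := hG.memS (y+1) (by omega) (by omega)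
  have hwm : w (w.symm (y+1)) = y+1 := by simp
  generalize w.symm (y+1) = m at hm hwm
  constructor
  · intro h
    rw [h] at e
    simp at e
    have h1 := hT.le_self k y le_rfl
    have h2 := (hq (R k y - 1) y (by omega)).1 (by omega)
    have h3 : ¬ (y+1 < w (k - (R k y - 1))) := by
      intro hh
      have := (hq (R k y - 1) (y+1) (by omega)).2 hh
      omega
    have h4 : w (k - (R k y - 1)) = w m := by omega
    have := w.injective h4
    omega
  · intro h
    by_contra hh
    simp at hh
    rw [hh] at e
    simp at e
    have h1 := hq (k - m) y (by omega)
    have h2 := hq (k - m) (y+1) (by omega)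
    rw [show k - (k - m) = m by omega] at h1 h2
    rw [e] at h2
    omega

theorem mt_of {g : Grid} {R : ℕ → ℕ → ℕ} {w : Perm'} {k n : ℕ} (hG : GP w k n) (hT : Top g R k n)
    (hb : Bot g w k n) (hq : HQ R w k) : Mt g n := by
  have hkn := hG.kn
  have hk1 := hG.k1
  refine ⟨hT.gn, ?_, ?_, ?_, ?_⟩
  · intro x y h1 h2 h3 h4
    obtain ⟨x, rfl⟩ : ∃ x', x = x' + 1 := ⟨x - 1, by omega⟩
    obtain ⟨y, rfl⟩ : ∃ y', y = y' + 1 := ⟨y - 1, by omega⟩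
    rcases lt_trichotomy (x+1) k with h | h | h
    · have e1 := hT.eS x y (by omega) (by omega)
      have e2 := hT.eN (x+1) y (by omega) (by omega)
      apply toNat_inj
      omega
    · rw [Bool.eq_iff_iff, h, hq_S hG hT hq y (by omega), hb.N (k+1) (y+1) (by omega) (by omega)
        (by omega) (by omega)]
      omega
    · rw [Bool.eq_iff_iff, hb.S _ _ h (by omega) (by omega) (by omega),
        hb.N _ _ (by omega) (by omega) (by omega) (by omega)]
      omega
  · intro x y h1 h2 h3 h4
    obtain ⟨x, rfl⟩ : ∃ x', x = x' + 1 := ⟨x - 1, by omega⟩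
    obtain ⟨y, rfl⟩ : ∃ y', y = y' + 1 := ⟨y - 1, by omega⟩
    rcases Nat.lt_or_ge x k with h | h
    · have e1 := hT.eE x y (by omega) (by omega)
      have e2 := hT.eW x (y+1) (by omega) (by omega)
      apply toNat_inj
      omega
    · rw [Bool.eq_iff_iff, hb.E _ _ (by omega) (by omega) (by omega) (by omega),
        hb.W _ _ (by omega) (by omega) (by omega) (by omega)]
      omega
  · intro x h1 h2
    obtain ⟨x, rfl⟩ : ∃ x', x = x' + 1 := ⟨x - 1, by omega⟩
    rcases Nat.lt_or_ge x k with h | h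
    · have e1 := hT.eW x 0 (by omega) (by omega)
      rw [hT.Rc _ (by omega), hT.Rc _ (by omega)] at e1
      apply toNat_inj
      simp only [zero_add] at e1
      simp only [Bool.toNat_false]
      omega
    · by_contra hh
      simp only [Bool.not_eq_false] at hh
      rw [hb.W _ _ (by omega) (by omega) (by omega) (by omega)] at hh
      have := hG.mem (x+1) (by omega) (by omega)
      omega
  · intro x y h1 h2 h3 h4
    obtain ⟨x, rfl⟩ : ∃ x', x = x' + 1 := ⟨x - 1, by omega⟩
    obtain ⟨y, rfl⟩ : ∃ y', y = y' + 1 := ⟨y - 1, by omega⟩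
    rcases Nat.lt_or_ge x k with h | h
    · exact (hT.nc x y h (by omega)).2
    · exact (hb.nb _ _ (by omega) (by omega) (by omega) (by omega)).1

theorem back_exists {g : Grid} {n : ℕ} (hM : Mt g n) (f : ℕ) : ∀ x y, 1 ≤ x → x ≤ n → 1 ≤ y →
    y ≤ n → n - x + y < f →
    (hasN (g.tile x y) = true → ∃ q, q ≤ y ∧ backAux g f x y true = some q) ∧
    (hasE (g.tile x y) = true → ∃ q, q ≤ y ∧ backAux g f x y false = some q) := by
  induction f with
  | zero => intro x y _ _ _ _ h; omega
  | succ f ih =>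
    intro x y h1 h2 h3 h4 h5
    have hnx : ¬ (g.n < x) := by rw [hM.gn]; omega
    have down : hasS (g.tile x y) = true →
        ∃ q, q ≤ y ∧ (if x = g.n then some y else backAux g f (x+1) y true) = some q := by
      intro hS
      rw [hM.gn]
      by_cases hx : x = n
      · exact ⟨y, le_rfl, by rw [if_pos hx]⟩
      · rw [if_neg hx]
        have hs := hM.s x y h1 (by omega) h3 h4
        rw [hS] at hs
        exact (ih (x+1) y (by omega) (by omega) h3 h4 (by omega)).1 hs.symm
    have left : hasW (g.tile x y) = true →
        ∃ q, q < y ∧ backAux g f x (y-1) false = some q := by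
      intro hW
      rcases Nat.eq_or_lt_of_le h3 with h | h
      · rw [← h, hM.l x h1 h2] at hW; simp at hW
      · have he := hM.e x (y-1) h1 h2 (by omega) (by omega)
        rw [show y - 1 + 1 = y by omega, hW] at he
        obtain ⟨q, hq, hq'⟩ := (ih x (y-1) h1 h2 (by omega) (by omega) (by omega)).2 he
        exact ⟨q, by omega, hq'⟩
    have hb := hM.nb x y h1 h2 h3 h4
    have left' : hasW (g.tile x y) = true →
        ∃ q, q ≤ y ∧ backAux g f x (y-1) false = some q := by
      intro h
      obtain ⟨q, hq, hq'⟩ := left h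
      exact ⟨q, hq.le, hq'⟩
    unfold backAux
    simp only [if_neg hnx, if_true]
    cases ht : g.tile x y <;> simp only [ht, hasS, hasW, ne_eq] at down left left' hb <;>
      simp only [hasN, hasE] <;> simp [down, left'] <;> simp at hb

theorem back_bot {g : Grid} {w : Perm'} {k n : ℕ} (hM : Mt g n) (hb : Bot g w k n)
    (f : ℕ) : ∀ x y, k < x → x ≤ n → 1 ≤ y → y ≤ n → n - x < f →
    hasN (g.tile x y) = true → backAux g f x y true = some y := by
  induction f with
  | zero => intro x y _ _ _ _ h; omega
  | succ f ih =>
    intro x y h1 h2 h3 h4 h5 hN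
    have hnx : ¬ (g.n < x) := by rw [hM.gn]; omega
    have hnb := hb.nb x y h1 h2 h3 h4
    have down : (if x = g.n then some y else backAux g f (x+1) y true) = some y := by
      rw [hM.gn]
      split_ifs with hx
      · rfl
      · apply ih (x+1) y (by omega) (by omega) h3 h4 (by omega)
        rw [hb.N _ _ h1 h2 h3 h4] at hN
        rw [hb.N _ _ (by omega) (by omega) h3 h4]
        omega
    unfold backAux
    simp only [if_neg hnx, if_true]
    cases ht : g.tile x y <;> simp [ht, hasN] at hN hnb ⊢ <;> simpa using down

theorem back_botE {g : Grid} {w : Perm'} {k n : ℕ} (hM : Mt g n) (hb : Bot g w k n) (hG : GP w k n)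
    (f : ℕ) : ∀ x y, k < x → x ≤ n → 1 ≤ y → y ≤ n → n - x + y < f →
    hasE (g.tile x y) = true → backAux g f x y false = some (w x) := by
  induction f with
  | zero => intro x y _ _ _ _ h; omega
  | succ f ih =>
    intro x y h1 h2 h3 h4 h5 hE
    have hnx : ¬ (g.n < x) := by rw [hM.gn]; omega
    have hnb := hb.nb x y h1 h2 h3 h4
    have e1 := hb.E x y h1 h2 h3 h4
    have e2 := hb.W x y h1 h2 h3 h4
    have hw := hG.mem x (by omega) h2
    unfold backAux
    simp only [if_neg hnx]
    rcases Nat.eq_or_lt_of_le (e1.1 hE) with h | h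
    · have hW : hasW (g.tile x y) = false := by
        by_contra hh
        simp only [Bool.not_eq_false] at hh
        have := e2.1 hh
        omega
      have hse : g.tile x y = Tile.se := by
        cases ht : g.tile x y <;> simp [ht, hasE, hasW] at hE hW hnb ⊢
      simp only [hse]
      rw [hM.gn]
      have : (if x = n then some y else backAux g f (x+1) y true) = some y := by
        split_ifs with hx
        · rfl
        · apply back_bot hM hb f (x+1) y (by omega) (by omega) h3 h4 (by omega)
          rw [hb.N _ _ (by omega) (by omega) h3 h4, ← h]
          simp
      simpa [h] using this
    · have hW := e2.2 h
      have := ih x (y-1) h1 h2 (by omega) (by omega) (by omega)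
        ((hb.E _ _ h1 h2 (by omega) (by omega)).2 (by omega))
      cases ht : g.tile x y <;> simp [ht, hasE, hasW] at hE hW hnb ⊢ <;> simpa using this

/-- following a pipe down in column `y` -/
theorem col_lemma {g : Grid} {R : ℕ → ℕ → ℕ} {w : Perm'} {k n : ℕ} (hG : GP w k n)
    (hT : Top g R k n) (hM : Mt g n) (hb : Bot g w k n) (y : ℕ) (hy1 : 1 ≤ y) (hyn : y ≤ n)
    (d : ℕ) : ∀ x f, x + d = k → 1 ≤ x → n - x + y < f → hasN (g.tile (x+1) y) = true →
    (∃ x', x < x' ∧ x' ≤ k ∧ g.tile x' y = Tile.nw ∧ (∀ t, x < t → t < x' → g.tile t y = Tile.vert) ∧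
      ∃ q, q < y ∧ backAux g f (x+1) y true = some q) ∨
    ((∀ t, x < t → t ≤ k → g.tile t y = Tile.vert) ∧ backAux g f (x+1) y true = some y) := by
  have hkn := hG.kn
  induction d with
  | zero =>
    intro x f h1 h2 h3 h4
    right
    refine ⟨fun t _ _ => by omega, ?_⟩
    exact back_bot hM hb f (x+1) y (by omega) (by omega) hy1 hyn (by omega) h4
  | succ d ih =>
    intro x f h1 h2 h3 h4
    obtain ⟨f, rfl⟩ : ∃ f', f = f' + 1 := ⟨f - 1, by omega⟩
    have hnx : ¬ (g.n < x + 1) := by rw [hM.gn]; omega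
    have hnx' : ¬ (x + 1 = g.n) := by rw [hM.gn]; omega
    have hnc := hT.nc x (y-1) (by omega) (by omega)
    rw [show y - 1 + 1 = y by omega] at hnc
    have hcase : g.tile (x+1) y = Tile.vert ∨ g.tile (x+1) y = Tile.nw := by
      cases ht : g.tile (x+1) y <;> simp [ht, hasN] at h4 hnc ⊢
    rcases hcase with ht | ht
    · have hN' : hasN (g.tile (x+1+1) y) = true := by
        rw [← hM.s (x+1) y (by omega) (by omega) hy1 hyn, ht]; rfl
      have e : backAux g (f+1) (x+1) y true = backAux g f (x+1+1) y true := by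
        conv_lhs => unfold backAux
        simp only [if_neg hnx, if_true, ht, if_neg hnx']
      rw [e]
      rcases ih (x+1) f (by omega) (by omega) (by omega) hN' with
        ⟨x', a1, a2, a3, a4, a5⟩ | ⟨a1, a2⟩
      · left
        refine ⟨x', by omega, a2, a3, ?_, a5⟩
        intro t t1 t2
        rcases Nat.eq_or_lt_of_le (show x + 1 ≤ t by omega) with h | h
        · rw [← h, ht]
        · exact a4 t h t2
      · right
        refine ⟨?_, a2⟩
        intro t t1 t2
        rcases Nat.eq_or_lt_of_le (show x + 1 ≤ t by omega) with h | h
        · rw [← h, ht]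
        · exact a1 t h t2
    · left
      refine ⟨x+1, by omega, by omega, ht, fun t _ _ => by omega, ?_⟩
      have hy2 : 1 < y := by
        rcases Nat.eq_or_lt_of_le hy1 with h | h
        · have := hM.l (x+1) (by omega) (by omega)
          subst h
          rw [ht] at this; simp [hasW] at this
        · exact h
      have he := hM.e (x+1) (y-1) (by omega) (by omega) (by omega) (by omega)
      rw [show y - 1 + 1 = y by omega, ht] at he
      obtain ⟨q, hq, hq'⟩ := (back_exists hM f (x+1) (y-1) (by omega) (by omega) (by omega)
        (by omega) (by omega)).2 he
      refine ⟨q, by omega, ?_⟩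
      rw [← hq']
      conv_lhs => unfold backAux
      simp only [if_neg hnx, if_true, ht]



structure Und (g : Grid) (R : ℕ → ℕ → ℕ) (k n a b s : ℕ) : Prop where
  top : Top g R k n
  s1 : 1 ≤ s
  sk : a + s ≤ k
  bn : b + 2 ≤ n
  blk : g.tile (a+1) (b+1) = Tile.blank
  nbl : g.tile (a+1) (b+2) ≠ Tile.blank
  ver : ∀ t, a + 1 < t → t ≤ a + s → g.tile t (b+2) = Tile.vert

theorem tl_blank (T : Tile) (h1 : T ≠ Tile.cross) (h2 : T ≠ Tile.bump) (h3 : hasE T = false)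
    (h4 : hasN T = false) : T = Tile.blank := by
  cases T <;> simp_all [hasE, hasN]

theorem tl_vse (T : Tile) (h1 : T ≠ Tile.cross) (h2 : T ≠ Tile.bump) (h3 : hasW T = false)
    (h4 : T ≠ Tile.blank) : T = Tile.vert ∨ T = Tile.se := by
  cases T <;> simp_all [hasW]

theorem tl_seh (T : Tile) (h1 : T ≠ Tile.cross) (h2 : T ≠ Tile.bump) (h3 : hasE T = true)
    (h4 : hasN T = false) : T = Tile.se ∨ T = Tile.horiz := by
  cases T <;> simp_all [hasE, hasN]

theorem toNat_zero (x : Bool) (h : x.toNat = 0) : x = false := by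
  cases x <;> simp_all

theorem toNat_one (x : Bool) (h : x.toNat = 1) : x = true := by
  cases x <;> simp_all

namespace Und
variable {g : Grid} {R : ℕ → ℕ → ℕ} {k n a b s : ℕ}

theorem base (h : Und g R k n a b s) : R a (b+1) = R a b ∧ R (a+1) b = R a b + 1 ∧
    R (a+1) (b+1) = R a b + 1 ∧ R (a+1) (b+2) = R a b ∧
    (g.tile (a+1) (b+2) = Tile.vert ∨ g.tile (a+1) (b+2) = Tile.se) := by
  have hT := h.top
  have h1 := h.s1
  have h2 := h.sk
  have h3 := h.bn
  have e1 := hT.eN a b (by omega) (by omega)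
  have e2 := hT.eS a b (by omega) (by omega)
  have e3 := hT.eW a b (by omega) (by omega)
  rw [h.blk] at e1 e2 e3
  simp [hasN, hasS, hasW] at e1 e2 e3
  have e4 := hT.eW a (b+1) (by omega) (by omega)
  have e5 := hT.eS a (b+1) (by omega) (by omega)
  have e6 := hT.nc a (b+1) (by omega) (by omega)
  have hW := toNat_zero (hasW (g.tile (a+1) (b+2))) (by
    rw [show b + 1 + 1 = b + 2 from rfl] at e4; omega)
  have hv := tl_vse _ e6.1 e6.2 hW h.nbl
  rw [show b + 1 + 1 = b + 2 from rfl] at e5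
  refine ⟨by omega, by omega, by omega, ?_, hv⟩
  rcases hv with hv | hv <;> rw [hv] at e5 <;> simp [hasS] at e5 <;> omega

theorem vals (h : Und g R k n a b s) (m : ℕ) (hm : m ≤ s) :
    R (a+m) b = R a b + m ∧ R (a+m) (b+1) = R a b + m ∧
    (1 ≤ m → R (a+m) (b+2) + 1 = R a b + m ∧ g.tile (a+m) (b+1) = Tile.blank) := by
  have hT := h.top
  have h1 := h.s1
  have h2 := h.sk
  have h3 := h.bn
  have hb := h.base
  induction m with
  | zero => simp [hb.1]
  | succ m ih =>
    obtain ⟨i1, i2, i3⟩ := ih (by omega)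
    rcases Nat.eq_zero_or_pos m with h0 | h0
    · subst h0
      simp only [zero_add]
      refine ⟨by omega, by omega, fun _ => ⟨by omega, h.blk⟩⟩
    · have hv := h.ver (a+(m+1)) (by omega) (by omega)
      rw [show a + (m+1) = (a + m) + 1 by omega] at hv ⊢
      have e1 := hT.eW (a+m) (b+1) (by omega) (by omega)
      have e2 := hT.eS (a+m) (b+1) (by omega) (by omega)
      rw [show b + 1 + 1 = b + 2 from rfl, hv] at e1 e2
      simp [hasW, hasS] at e1 e2
      have e3 := hT.eE (a+m) b (by omega) (by omega)
      have e4 := hT.eN (a+m) b (by omega) (by omega)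
      have e5 := hT.nc (a+m) b (by omega) (by omega)
      have hbl := tl_blank _ e5.1 e5.2 (toNat_zero _ (by omega)) (toNat_zero _ (by omega))
      have e6 := hT.eS (a+m) b (by omega) (by omega)
      rw [hbl] at e6
      simp [hasS] at e6
      exact ⟨by omega, by omega, fun _ => ⟨by omega, hbl⟩⟩

theorem ge (h : Top g R k n) (a b : ℕ) (ha : a ≤ k) : a ≤ R a b + b := by
  induction b with
  | zero => rw [h.Rc a ha]; omega
  | succ b ih => have := h.right a b ha; omega

end Und

def RU (R : ℕ → ℕ → ℕ) (a b s : ℕ) : ℕ → ℕ → ℕ := fun t y =>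
  if y = b + 1 ∧ a + 1 ≤ t ∧ t ≤ a + s then R t y - 1 else R t y

theorem RU_in (R : ℕ → ℕ → ℕ) (a b s t y : ℕ) (h : y = b + 1 ∧ a + 1 ≤ t ∧ t ≤ a + s) :
    RU R a b s t y = R t y - 1 := by
  unfold RU; rw [if_pos h]

theorem RU_out (R : ℕ → ℕ → ℕ) (a b s t y : ℕ) (h : ¬ (y = b + 1 ∧ a + 1 ≤ t ∧ t ≤ a + s)) :
    RU R a b s t y = R t y := by
  unfold RU; rw [if_neg h]

/-- the tile conditions at one cell -/
def CellOK (T : Tile) (p q p' q' : ℕ) : Prop :=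
  (T ≠ Tile.cross ∧ T ≠ Tile.bump) ∧ q + (hasN T).toNat = p ∧ q' + (hasS T).toNat = p' ∧
    p' + (hasW T).toNat = p + 1 ∧ q' + (hasE T).toNat = q + 1

namespace Und
variable {g : Grid} {R : ℕ → ℕ → ℕ} {k n a b s i' : ℕ}

def Low (g : Grid) (k n a b s i' : ℕ) : Prop :=
  (a + s < k ∧ i' = a + s + 1 ∧ g.tile (a+s+1) (b+2) = Tile.nw) ∨
    (a + s = k ∧ k < i' ∧ i' ≤ n)

set_option maxHeartbeats 1000000 in
theorem cell (h : Und g R k n a b s) (hl : Low g k n a b s i') (p q : ℕ) (hp : p < k) (hq : q < n) :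
    CellOK (nablaUndroop g.tile (a+1) i' (b+1) (p+1) (q+1)) (RU R a b s p q) (RU R a b s p (q+1))
      (RU R a b s (p+1) q) (RU R a b s (p+1) (q+1)) := by
  have hT := h.top
  have h1 := h.s1
  have h2 := h.sk
  have h3 := h.bn
  have old : CellOK (g.tile (p+1) (q+1)) (R p q) (R p (q+1)) (R (p+1) q) (R (p+1) (q+1)) :=
    ⟨hT.nc p q hp hq, hT.eN p q hp hq, hT.eS p q hp hq, hT.eW p q hp hq, hT.eE p q hp hq⟩
  have hb := h.base
  have hi' : a + s < i' := by rcases hl with hl | hl <;> omega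
  have hi'' : p + 1 ≤ a + s ∨ (a + s < k ∧ i' = a + s + 1 ∧ g.tile (a+s+1) (b+2) = Tile.nw) := by
    rcases hl with hl | hl
    · right; exact hl
    · left; omega
  by_cases hr : p < a ∨ a + s < p
  · have e1 : nablaUndroop g.tile (a+1) i' (b+1) (p+1) (q+1) = g.tile (p+1) (q+1) := by
      unfold nablaUndroop
      rw [if_neg (by omega), if_neg (by omega), if_neg (by omega), if_neg (by omega),
        if_neg (by omega), if_neg (by omega)]
    rw [e1]
    rw [RU_out R a b s p q (by omega),
      RU_out R a b s p (q+1) (by omega),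
      RU_out R a b s (p+1) q (by omega),
      RU_out R a b s (p+1) (q+1) (by omega)]
    exact old
  · push Not at hr
    by_cases hc : q ≠ b ∧ q ≠ b + 1
    · have e1 : nablaUndroop g.tile (a+1) i' (b+1) (p+1) (q+1) = g.tile (p+1) (q+1) := by
        unfold nablaUndroop
        rw [if_neg (by omega), if_neg (by omega), if_neg (by omega), if_neg (by omega),
          if_neg (by omega), if_neg (by omega)]
      rw [e1]
      rw [RU_out R a b s p q (by omega),
        RU_out R a b s p (q+1) (by omega),
        RU_out R a b s (p+1) q (by omega),
        RU_out R a b s (p+1) (q+1) (by omega)]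
      exact old
    · have hc : q = b ∨ q = b + 1 := by omega
      obtain ⟨m, rfl⟩ : ∃ m, p = a + m := ⟨p - a, by omega⟩
      obtain ⟨v1, v2, v3⟩ := h.vals m (by omega)
      rcases Nat.eq_zero_or_pos m with hm | hm
      · subst hm
        clear hi''
        rw [add_zero] at *
        rcases hc with rfl | rfl
        · have e1 : nablaUndroop g.tile (a+1) i' (q+1) (a+1) (q+1) = Tile.se := by
            unfold nablaUndroop
            rw [if_pos (by omega)]
            simp [h.blk]
          rw [e1]
          rw [RU_out R a q s a q (by omega),
            RU_out R a q s a (q+1) (by omega),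
            RU_out R a q s (a+1) q (by omega),
            RU_in R a q s (a+1) (q+1) (by omega)]
          unfold CellOK
          simp [hasN, hasS, hasE, hasW]
          omega
        · have e1 : (g.tile (a+1) (b+2) = Tile.se ∧
                nablaUndroop g.tile (a+1) i' (b+1) (a+1) (b+1+1) = Tile.horiz) ∨
              (g.tile (a+1) (b+2) = Tile.vert ∧
                nablaUndroop g.tile (a+1) i' (b+1) (a+1) (b+1+1) = Tile.nw) := by
            unfold nablaUndroop
            rw [if_neg (by omega), if_neg (by omega), if_pos (by omega)]
            rcases hb.2.2.2.2 with hv | hv <;> simp [hv]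
          rw [RU_out R a b s a (b+1) (by omega),
            RU_out R a b s a (b+1+1) (by omega),
            RU_in R a b s (a+1) (b+1) (by omega),
            RU_out R a b s (a+1) (b+1+1) (by omega)]
          rw [show b + 1 + 1 = b + 2 from rfl] at *
          unfold CellOK at *
          rcases e1 with ⟨hv, hv'⟩ | ⟨hv, hv'⟩ <;> rw [hv] at old <;> rw [hv'] <;>
            simp [hasN, hasS, hasE, hasW] at old ⊢ <;> omega
      · rcases Nat.lt_or_ge m s with hms | hms
        · obtain ⟨u1, u2, u3⟩ := h.vals (m+1) (by omega)
          rw [show a + (m+1) = a + m + 1 by omega] at u1 u2 u3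
          have u3 := u3 (by omega)
          have v3 := v3 (by omega)
          rcases hc with rfl | rfl
          · have e1 : nablaUndroop g.tile (a+1) i' (q+1) (a+m+1) (q+1) = Tile.vert := by
              unfold nablaUndroop
              rw [if_neg (by omega), if_neg (by omega), if_neg (by omega), if_neg (by omega),
                if_pos (by omega)]
              simp [u3.2]
            rw [e1]
            rw [RU_out R a q s (a+m) q (by omega),
              RU_in R a q s (a+m) (q+1) (by omega),
              RU_out R a q s (a+m+1) q (by omega),
              RU_in R a q s (a+m+1) (q+1) (by omega)]
            unfold CellOK
            simp [hasN, hasS, hasE, hasW]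
            omega
          · have e1 : nablaUndroop g.tile (a+1) i' (b+1) (a+m+1) (b+1+1) = Tile.blank := by
              unfold nablaUndroop
              rw [if_neg (by omega), if_neg (by omega), if_neg (by omega), if_neg (by omega),
                if_neg (by omega), if_pos (by omega)]
              simp [h.ver (a+m+1) (by omega) (by omega)]
            rw [e1]
            rw [RU_in R a b s (a+m) (b+1) (by omega),
              RU_out R a b s (a+m) (b+1+1) (by omega),
              RU_in R a b s (a+m+1) (b+1) (by omega),
              RU_out R a b s (a+m+1) (b+1+1) (by omega)]
            unfold CellOK
            simp [hasN, hasS, hasE, hasW]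
            rw [show b + 1 + 1 = b + 2 from rfl]
            omega
        · have hms' : m = s := by omega
          subst hms'
          obtain ⟨k1, k2, k3⟩ : a + m < k ∧ i' = a + m + 1 ∧ g.tile (a+m+1) (b+2) = Tile.nw := by
            rcases hi'' with hh | hh
            · omega
            · exact hh
          subst k2
          have v3 := v3 (by omega)
          have w1 := hT.eW (a+m) (b+1) (by omega) (by omega)
          have w2 := hT.eE (a+m) (b+1) (by omega) (by omega)
          rw [show b + 1 + 1 = b + 2 from rfl, k3] at w1 w2
          simp [hasW, hasE] at w1 w2
          rcases hc with rfl | rfl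
          · have z1 : hasE (g.tile (a+m+1) (q+1)) = true := by
              apply toNat_one; unfold CellOK at old; omega
            have z2 : hasN (g.tile (a+m+1) (q+1)) = false := by
              apply toNat_zero; unfold CellOK at old; omega
            have z3 := tl_seh _ old.1.1 old.1.2 z1 z2
            have e1 : (g.tile (a+m+1) (q+1) = Tile.se ∧
                  nablaUndroop g.tile (a+1) (a+m+1) (q+1) (a+m+1) (q+1) = Tile.vert) ∨
                (g.tile (a+m+1) (q+1) = Tile.horiz ∧
                  nablaUndroop g.tile (a+1) (a+m+1) (q+1) (a+m+1) (q+1) = Tile.nw) := by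
              unfold nablaUndroop
              rw [if_neg (by omega), if_pos (by omega)]
              rcases z3 with hv | hv <;> simp [hv]
            rw [RU_out R a q m (a+m) q (by omega),
              RU_in R a q m (a+m) (q+1) (by omega),
              RU_out R a q m (a+m+1) q (by omega),
              RU_out R a q m (a+m+1) (q+1) (by omega)]
            unfold CellOK at *
            rcases e1 with ⟨hv, hv'⟩ | ⟨hv, hv'⟩ <;> rw [hv] at old <;> rw [hv'] <;>
              simp [hasN, hasS, hasE, hasW] at old ⊢ <;> omega
          · have e1 : nablaUndroop g.tile (a+1) (a+m+1) (b+1) (a+m+1) (b+1+1) = Tile.blank := by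
              unfold nablaUndroop
              rw [if_neg (by omega), if_neg (by omega), if_neg (by omega), if_pos (by omega)]
              simp [k3]
            rw [e1]
            rw [RU_in R a b m (a+m) (b+1) (by omega),
              RU_out R a b m (a+m) (b+1+1) (by omega),
              RU_out R a b m (a+m+1) (b+1) (by omega),
              RU_out R a b m (a+m+1) (b+1+1) (by omega)]
            rw [show b + 1 + 1 = b + 2 from rfl] at *
            unfold CellOK at *
            rw [k3] at old
            simp [hasN, hasS, hasE, hasW] at old ⊢
            omega

theorem top' (h : Und g R k n a b s) (hl : Low g k n a b s i') :
    Top ⟨g.n, nablaUndroop g.tile (a+1) i' (b+1)⟩ (RU R a b s) k n := by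
  have hT := h.top
  have h1 := h.s1
  have h2 := h.sk
  have h3 := h.bn
  have hkn := hT.kn
  have hc := h.cell hl
  refine ⟨hT.kn, hT.gn, ?_, ?_, ?_, ?_, fun p q hp hq => (hc p q hp hq).1,
    fun p q hp hq => (hc p q hp hq).2.1, fun p q hp hq => (hc p q hp hq).2.2.1,
    fun p q hp hq => (hc p q hp hq).2.2.2.1, fun p q hp hq => (hc p q hp hq).2.2.2.2⟩
  · intro x y hxy
    have hxy' : ¬ InGrid g x y := hxy
    have hh := hT.out x y hxy'
    unfold InGrid at hxy'
    rw [hT.gn] at hxy'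
    have hi : a + s < i' ∧ i' ≤ n := by rcases hl with hl | hl <;> omega
    show nablaUndroop g.tile (a+1) i' (b+1) x y = Tile.horiz
    unfold nablaUndroop
    rw [if_neg (by omega), if_neg (by omega), if_neg (by omega), if_neg (by omega),
        if_neg (by omega), if_neg (by omega)]
    exact hh
  · intro j
    unfold RU
    rw [if_neg (by omega)]
    exact hT.R0 j
  · intro i hi
    unfold RU
    rw [if_neg (by omega)]
    exact hT.Rc i hi
  · intro i j hi hj
    unfold RU
    rw [if_neg (by omega)]
    exact hT.Rn i j hi hj

theorem TR1 (h : Und g R k n a b s) (q : ℕ) (hq : q < s) :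
    TR R (R a b + q) (R a b + b - a) = a + q + 1 := by
  have h2 := h.sk
  have hge := ge h.top a b (by omega)
  apply h.top.TR_eq _ _ _ (by omega)
  · rw [show a + q + 1 + (R a b + b - a) - (R a b + q) = b + 1 by omega]
    have := (h.vals (q+1) (by omega)).2.1
    rw [show a + (q+1) = a + q + 1 by omega] at this
    omega
  · rw [show a + q + (R a b + b - a) - (R a b + q) = b by omega]
    have := (h.vals q (by omega)).1
    omega

theorem TR2 (h : Und g R k n a b s) (hl : Low g k n a b s i') (q : ℕ) (hq : q + 1 < s) :
    TR (RU R a b s) (R a b + q) (R a b + b - a) = a + q + 2 := by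
  have h2 := h.sk
  have hge := ge h.top a b (by omega)
  apply (h.top' hl).TR_eq _ _ (a+q+1) (by omega)
  · rw [show a + q + 1 + 1 + (R a b + b - a) - (R a b + q) = b + 2 by omega]
    have := ((h.vals (q+2) (by omega)).2.2 (by omega)).1
    rw [show a + (q+2) = a + q + 1 + 1 by omega] at this
    unfold RU
    rw [if_neg (by omega)]
    omega
  · rw [show a + q + 1 + (R a b + b - a) - (R a b + q) = b + 1 by omega]
    have := (h.vals (q+1) (by omega)).2.1
    rw [show a + (q+1) = a + q + 1 by omega] at this
    unfold RU
    rw [if_pos (by omega)]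
    omega

theorem TR3 (h : Und g R k n a b s) (r' c' : ℕ)
    (hne : ¬ (c' = R a b + b - a ∧ R a b ≤ r' ∧ r' < R a b + s)) :
    TR (RU R a b s) r' c' = TR R r' c' := by
  have h2 := h.sk
  have hge := ge h.top a b (by omega)
  unfold TR
  congr 1
  ext i
  simp only [Set.mem_ofPred_eq]
  unfold RU
  split_ifs with hh
  · obtain ⟨m, rfl⟩ : ∃ m, i = a + m := ⟨i - a, by omega⟩
    have := (h.vals m (by omega)).2.1
    rw [hh.1, this]
    omega
  · rfl

end Und


theorem find_first (P : ℕ → Bool) (n x : ℕ) (h1 : 1 ≤ x) (hx : x ≤ n) (hP : P x = true)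
    (hn : ∀ y, 1 ≤ y → y < x → P y = false) : (List.range' 1 n).find? P = some x := by
  rw [List.find?_range'_eq_some]
  refine ⟨hP, ?_, ?_⟩
  · simp [List.mem_range'_1]; omega
  · intro y hy1 hy2
    simp [hn y hy1 hy2]

theorem slide_eq (g : Grid) (i j d : ℕ) (hd : d + 1 < g.n + 1)
    (h1 : ∀ t, t ≤ d → g.tile i (j+t) = Tile.blank) (h2 : g.tile i (j+d+1) ≠ Tile.blank) :
    slideEast g i j = j + d := by
  unfold slideEast
  have e : List.range' j (g.n+1) = List.range' j (d+1) ++ List.range' (j+(d+1)) (g.n - d) := by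
    rw [List.range'_append_1]; congr 1; omega
  have e2 : List.range' (j+(d+1)) (g.n - d) = (j+(d+1)) :: List.range' (j+(d+1)+1) (g.n - d - 1) := by
    rw [← List.range'_succ]; congr 1; omega
  rw [e, List.takeWhile_append_of_pos, e2, List.takeWhile_cons_of_neg]
  · rw [List.append_nil, List.range'_concat]
    simp
  · simpa [add_assoc] using h2
  · intro x hx
    rw [List.mem_range'_1] at hx
    have := h1 (x - j) (by omega)
    rw [show j + (x - j) = x by omega] at this
    simp [this]

theorem qPairs_nil (g : Grid) (i i' j : ℕ) (h : ∀ t, i < t → t < i' → g.tile t j ≠ Tile.se) :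
    qPairs g i i' j = [] := by
  unfold qPairs
  rw [List.filterMap_eq_nil_iff]
  intro t _
  rw [if_neg]
  rintro ⟨h1, h2, h3⟩
  exact h t h1 h2 h3

theorem nablaIter_eq (g : Grid) (i i' j : ℕ) (h : ∀ t, i < t → t < i' → g.tile t j ≠ Tile.se) :
    nablaIter g i i' j = ⟨g.n, nablaUndroop g.tile i i' j⟩ := by
  unfold nablaIter
  rw [qPairs_nil g i i' j h]
  rfl

theorem cell_iff {g : Grid} {R : ℕ → ℕ → ℕ} {w : Perm'} {k n : ℕ} (hG : GP w k n)
    (hT : Top g R k n) (hq : HQ R w k) (r c : ℕ) :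
    c < lamW w k r ↔ r < R k (k + c - r) := by
  rcases Nat.lt_or_ge r k with h | h
  · rw [hq r _ h]
    unfold lamW
    omega
  · have := hT.le_self k (k + c - r) le_rfl
    unfold lamW
    rw [show k - r = 0 by omega, hG.w0]
    omega

/-- entering the column from the top down to the bottom of the undroop -/
theorem jdt_step {g : Grid} {R : ℕ → ℕ → ℕ} {w : Perm'} {k n a b s i' : ℕ} (hG : GP w k n)
    (hU : Und g R k n a b s) (hl : Und.Low g k n a b s i') (hq : HQ R w k) (L : ℕ)
    (hL : ∀ r, 0 < lamW w k r ↔ r < L) (f : ℕ) :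
    jdtAux (f + 1 + (s - 1)) (mkT L (lamW w k) (TR R)) (R a b) (R a b + b - a)
      = jdtAux (f + 1) (mkT L (lamW w k) (TR (RU R a b s))) (R a b + (s - 1)) (R a b + b - a) := by
  have hT := hU.top
  have hs := hU.s1
  have hsk := hU.sk
  have hge := Und.ge hT a b (by omega)
  have hL0 : ∀ r, L ≤ r → lamW w k r = 0 := by
    intro r hr
    have := hL r
    omega
  rw [jdt_downs L _ _ hL0]
  · apply jdt_congr L _ _ _ hL0
    intro r' c' h1 h2 h3
    beta_reduce
    by_cases hc : c' = R a b + b - a ∧ R a b ≤ r' ∧ r' < R a b + (s - 1)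
    · rw [if_pos hc, hc.1]
      have e1 := hU.TR1 (r' + 1 - R a b) (by omega)
      have e2 := hU.TR2 hl (r' - R a b) (by omega)
      rw [show R a b + (r' + 1 - R a b) = r' + 1 by omega] at e1
      rw [show R a b + (r' - R a b) = r' by omega] at e2
      omega
    · rw [if_neg hc, hU.TR3]
      omega
  · intro t ht1 ht2
    rw [cell_iff hG hT hq]
    have := hT.D_mono (R a b + t) (R a b + b - a) (a + (t + 1)) k (by omega) le_rfl
    rw [show a + (t+1) + (R a b + b - a) - (R a b + t) = b + 1 by omega] at this
    have := (hU.vals (t+1) (by omega)).2.1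
    omega
  · intro t ht h
    rw [show R a b + t + 1 = R a b + (t + 1) by omega, hU.TR1 (t+1) (by omega)]
    rw [cell_iff hG hT hq] at h
    have := hT.TR_lt _ _ (a+(t+1)) h (by omega) (by
      rw [show a + (t+1) + (R a b + b - a + 1) - (R a b + t) = b + 2 by omega]
      have := ((hU.vals (t+1) (by omega)).2.2 (by omega)).1
      omega)
    omega

/-- slide along a row of blanks -/
theorem jdt_row {g : Grid} {R : ℕ → ℕ → ℕ} {w : Perm'} {k n : ℕ} (hG : GP w k n)
    (hT : Top g R k n) (hq : HQ R w k) (L : ℕ) (hL : ∀ r, 0 < lamW w k r ↔ r < L)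
    (a r c d f : ℕ) (hak : a < k) (hca : r ≤ a + c)
    (hv : ∀ t, t ≤ d → R a (a + c + t - r) = r ∧ R (a+1) (a + c + t - r + 1) = r + 1) :
    jdtAux (f + d) (mkT L (lamW w k) (TR R)) r c = jdtAux f (mkT L (lamW w k) (TR R)) r (c + d) := by
  have hL0 : ∀ r, L ≤ r → lamW w k r = 0 := by
    intro r hr
    have := hL r
    omega
  apply jdt_slide L _ _ hL0 r (a+1)
  · intro c hc
    rw [cell_iff hG hT hq] at hc
    exact hT.col_strict r c hc
  · rw [cell_iff hG hT hq]
    have := hT.D_mono r (c+d) (a+1) k (by omega) le_rfl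
    have h2 := (hv d le_rfl).2
    rw [show a + c + d - r + 1 = a + 1 + (c + d) - r by omega] at h2
    omega
  · intro t ht
    obtain ⟨h1, h2⟩ := hv t ht
    rw [show a + c + t - r + 1 = a + 1 + (c + t) - r by omega] at h2
    rw [show a + c + t - r = a + (c + t) - r by omega] at h1
    exact hT.TR_eq r (c+t) a hak (by omega) (by omega)

/-- values along a row of blanks -/
theorem blank_row {g : Grid} {R : ℕ → ℕ → ℕ} {k n : ℕ} (hT : Top g R k n) (a b d : ℕ) (ha : a < k)
    (hb : ∀ t, t ≤ d → g.tile (a+1) (b+1+t) = Tile.blank) (hn : b + d < n) :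
    ∀ t, t ≤ d → R a (b+t) = R a b ∧ R (a+1) (b+t+1) = R a b + 1 := by
  intro t
  induction t with
  | zero =>
    intro h
    have e1 := hb 0 (by omega)
    have := (hT.blank_iff a b ha (by omega)).1.1 e1
    simpa using this
  | succ t ih =>
    intro h
    obtain ⟨i1, i2⟩ := ih (by omega)
    have e1 := hb (t+1) h
    have e2 := hb t (by omega)
    rw [show b + 1 + (t+1) = (b + (t+1)) + 1 by omega] at e1
    rw [show b + 1 + t = (b + t) + 1 by omega] at e2
    have := (hT.blank_iff a (b+(t+1)) ha (by omega)).1.1 e1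
    have e3 := hT.eN a (b+t) ha (by omega)
    rw [e2] at e3
    simp [hasN] at e3
    rw [show b + (t+1) = b + t + 1 by omega] at *
    omega

/-- the last blank of a block -/
theorem blank_last {g : Grid} {R : ℕ → ℕ → ℕ} {k n : ℕ} (hT : Top g R k n) (a b : ℕ) (ha : a < k)
    (hb : g.tile (a+1) (b+1) = Tile.blank) (hn : b < n) :
    ∃ d, b + d + 2 ≤ n ∧ (∀ t, t ≤ d → g.tile (a+1) (b+1+t) = Tile.blank) ∧
      g.tile (a+1) (b+1+d+1) ≠ Tile.blank := by
  classical
  have hnn : g.tile (a+1) n ≠ Tile.blank := by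
    intro h
    have e := hT.eE a (n-1) ha (by omega)
    rw [show n - 1 + 1 = n by omega, h, hT.Rn _ _ (by omega) le_rfl] at e
    simp [hasE] at e
  have hbn : b + 1 ≠ n := by
    intro h; rw [h] at hb; exact hnn hb
  have ex : ∃ d, g.tile (a+1) (b+1+d+1) ≠ Tile.blank :=
    ⟨n - b - 2, by rwa [show b + 1 + (n - b - 2) + 1 = n by omega]⟩
  have hle : Nat.find ex ≤ n - b - 2 :=
    Nat.find_min' ex (by rwa [show b + 1 + (n - b - 2) + 1 = n by omega])
  refine ⟨Nat.find ex, by omega, ?_, Nat.find_spec ex⟩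
  intro t ht
  rcases t with _ | t
  · simpa using hb
  · have := Nat.find_min ex (m := t) (by omega)
    simpa [add_assoc] using this



section
variable {g : Grid} {R : ℕ → ℕ → ℕ} {w : Perm'} {k n a b s i' : ℕ}

theorem fin_x0 (hG : GP w k n) (hU : Und g R k n a b s) (hk : a + s = k) (hq : HQ R w k) :
    k < w.symm (b+1) ∧ w.symm (b+1) ≤ n := by
  have hbn := hU.bn
  have h1 := (hU.vals s le_rfl).2.2 hU.s1
  have h2 := hq_S hG hU.top hq b (by omega)
  rw [hk] at h1
  rw [h1.2] at h2
  simp [hasS] at h2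
  exact ⟨h2, (hG.memS (b+1) (by omega) (by omega)).2⟩

theorem fin_w (hG : GP w k n) (hU : Und g R k n a b s) (hk : a + s = k) (hq : HQ R w k) :
    R a b + (s - 1) < k ∧ w (k - (R a b + (s-1))) = b + 2 := by
  have hs := hU.s1
  obtain ⟨h1, h2, h3⟩ := hU.vals s le_rfl
  have h3 := (h3 hU.s1).1
  rw [hk] at h1 h2 h3
  have := hU.top.le_self k (b+1) le_rfl
  have hlt : R a b + (s-1) < k := by omega
  refine ⟨hlt, ?_⟩
  have q1 := (hq _ (b+1) hlt).1 (by omega)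
  have q2 := mt (hq _ (b+2) hlt).2 (by omega)
  omega

theorem sT_app (w : Perm') (b x : ℕ) : (sT (b+1) * w) x =
    if w x = b + 1 then b + 2 else if w x = b + 2 then b + 1 else w x := by
  unfold sT
  rw [Equiv.Perm.mul_apply, Equiv.swap_apply_def]

theorem fin_ne (hG : GP w k n) (hU : Und g R k n a b s) (hk : a + s = k) (hq : HQ R w k) (x : ℕ)
    (hx : x ≤ k) : w x ≠ b + 1 := by
  intro h
  have h1 := (fin_x0 hG hU hk hq).1
  rw [← h, Equiv.symm_apply_apply] at h1
  omega

theorem fin_eq (hG : GP w k n) (hU : Und g R k n a b s) (hk : a + s = k) (hq : HQ R w k) (x : ℕ)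
    (h : w x = b + 2) : x = k - (R a b + (s-1)) := by
  have h1 := (fin_w hG hU hk hq).2
  exact w.injective (h.trans h1.symm)

theorem fin_GP (hG : GP w k n) (hU : Und g R k n a b s) (hk : a + s = k) (hq : HQ R w k) :
    GP (sT (b+1) * w) k n := by
  have hbn := hU.bn
  refine ⟨hG.k1, hG.kn, ?_, ?_, ?_, ?_⟩
  · rw [sT_app, hG.w0]; rw [if_neg (by omega), if_neg (by omega)]
  · intro x hx
    rw [sT_app, hG.fx x hx]; rw [if_neg (by omega), if_neg (by omega)]
  · intro i j h1 h2 h3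
    have e := hG.inc1 i j h1 h2 h3
    have e1 := fin_ne hG hU hk hq i (by omega)
    have e2 := fin_ne hG hU hk hq j (by omega)
    rw [sT_app, sT_app]
    split_ifs <;> omega
  · intro i j h1 h2
    have e := hG.inc2 i j h1 h2
    have e1 := mt (fin_eq hG hU hk hq i) (by omega)
    have e2 := mt (fin_eq hG hU hk hq j) (by omega)
    rw [sT_app, sT_app]
    split_ifs <;> omega

theorem fin_HQ (hG : GP w k n) (hU : Und g R k n a b s) (hk : a + s = k) (hq : HQ R w k) :
    HQ (RU R a b s) (sT (b+1) * w) k := by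
  intro r j hr
  have hs := hU.s1
  obtain ⟨h1, h2, h3⟩ := hU.vals s le_rfl
  rw [hk] at h1 h2 h3
  have hw := fin_w hG hU hk hq
  have q := hq r j hr
  have e1 := fin_ne hG hU hk hq (k - r) (by omega)
  rw [sT_app, if_neg e1]
  by_cases hj : j = b + 1
  · subst hj
    rw [RU_in _ _ _ _ _ _ (by omega)]
    split_ifs with h
    · have := fin_eq hG hU hk hq _ h
      omega
    · have : r ≠ R a b + (s-1) := by
        intro hh; rw [hh] at h; omega
      omega
  · rw [RU_out _ _ _ _ _ _ (by omega), q]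
    split_ifs with h
    · omega
    · rfl

theorem fin_lam (hG : GP w k n) (hU : Und g R k n a b s) (hk : a + s = k) (hq : HQ R w k) :
    lamW (sT (b+1) * w) k = fun r' => if r' = R a b + (s-1) then R a b + b - a else lamW w k r' := by
  funext r
  have hs := hU.s1
  have hge := Und.ge hU.top a b (by omega)
  have hw := fin_w hG hU hk hq
  have e1 := fin_ne hG hU hk hq (k - r) (by omega)
  unfold lamW
  rw [sT_app, if_neg e1]
  split_ifs with h h' h'
  · omega
  · have := fin_eq hG hU hk hq _ h
    omega
  · rw [h'] at h
    exact absurd hw.2 h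
  · rfl

theorem fin_jdt (hG : GP w k n) (hU : Und g R k n a b s) (hk : a + s = k) (hq : HQ R w k) (L : ℕ)
    (hL : ∀ r, 0 < lamW w k r ↔ r < L) (T : ℕ → ℕ → ℕ) (f L' : ℕ)
    (hL' : ∀ r, 0 < lamW (sT (b+1) * w) k r ↔ r < L') :
    jdtAux (f + 1) (mkT L (lamW w k) T) (R a b + (s-1)) (R a b + b - a)
      = mkT L' (lamW (sT (b+1) * w) k) T := by
  have hs := hU.s1
  have hge := Und.ge hU.top a b (by omega)
  have hw := fin_w hG hU hk hq
  have hlam := fin_lam hG hU hk hq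
  have hl1 : lamW w k (R a b + (s-1)) = R a b + b - a + 1 := by
    unfold lamW; rw [hw.2]; omega
  have hL0 : ∀ r, L ≤ r → lamW w k r = 0 := by
    intro r hr
    have := hL r
    omega
  rw [hlam]
  rw [hlam] at hL'
  apply jdt_end L L' _ _ hL0
  · exact hl1
  · have := mt (cell_iff hG hU.top hq (R a b + (s-1) + 1) (R a b + b - a)).1 (by
      have := (hU.vals s le_rfl).1
      rw [hk] at this
      rw [show k + (R a b + b - a) - (R a b + (s - 1) + 1) = b by omega]
      omega)
    omega
  · intro r' _
    exact hL' r'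
  · by_contra hh
    have h1 := (hL' L).2 (by omega)
    have h2 := hL L
    have h3 := hL (R a b + (s-1))
    beta_reduce at h1
    split_ifs at h1 <;> omega

end

theorem tl_cross (T : Tile) (h1 : T ≠ Tile.bump) (h2 : hasE T = true) (h3 : hasW T = true)
    (h4 : hasS T = true) : T = Tile.cross := by
  cases T <;> simp_all [hasE, hasW, hasS]

theorem loop (w : Perm') (k n L : ℕ) (hG : GP w k n) (hL : ∀ r, 0 < lamW w k r ↔ r < L) (F : ℕ) :
    ∀ (g : Grid) (R : ℕ → ℕ → ℕ) (a b0 f : ℕ), Top g R k n → Bot g w k n → HQ R w k → a < k → b0 < n →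
    g.tile (a+1) (b0+1) = Tile.blank → n ≤ F + b0 →
    L + lamW w k 0 ≤ f + R a b0 + (R a b0 + b0 - a) →
    ∃ R', Top (nablaLoop g F (a+1, b0+1)).1 R' k n ∧
      GP (sT (nablaLoop g F (a+1, b0+1)).2 * w) k n ∧
      HQ R' (sT (nablaLoop g F (a+1, b0+1)).2 * w) k ∧
      ∀ L', (∀ r, 0 < lamW (sT (nablaLoop g F (a+1, b0+1)).2 * w) k r ↔ r < L') →
        jdtAux f (mkT L (lamW w k) (TR R)) (R a b0) (R a b0 + b0 - a)
          = mkT L' (lamW (sT (nablaLoop g F (a+1, b0+1)).2 * w) k) (TR R') := by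
  induction F with
  | zero => intro g R a b0 f _ _ _ _ h1 _ h2; omega
  | succ F ih =>
    intro g R a b0 f hT hb hq hak hb0 hbl hF hf
    have hkn := hG.kn
    have hM := mt_of hG hT hb hq
    obtain ⟨d, hd, hbd, hnbd⟩ := blank_last hT a b0 hak hbl hb0
    have hrow := blank_row hT a b0 d hak hbd (by omega)
    have hslide : slideEast g (a+1) (b0+1) = b0 + 1 + d :=
      slide_eq g (a+1) (b0+1) d (by rw [hT.gn]; omega) hbd hnbd
    have hgea := Und.ge hT a b0 hak.le
    obtain ⟨b, hbdef⟩ : ∃ b, b = b0 + d := ⟨_, rfl⟩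
    have hRb : R a b = R a b0 := by rw [hbdef]; exact (hrow d le_rfl).1
    have hblb : g.tile (a+1) (b+1) = Tile.blank := by
      have := hbd d le_rfl
      rwa [show b0 + 1 + d = b + 1 by omega] at this
    rw [show b0 + 1 + d + 1 = b + 2 by omega] at hnbd
    rw [show b0 + 1 + d = b + 1 by omega] at hslide
    -- the row slide
    have hc0 : R a b0 + b0 - a + d = R a b + b - a := by omega
    have hcell : R a b + b - a < lamW w k (R a b) := by
      rw [cell_iff hG hT hq]
      have h1 := hT.D_mono (R a b) (R a b + b - a) (a+1) k (by omega) le_rfl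
      rw [show a + 1 + (R a b + b - a) - R a b = b + 1 by omega] at h1
      have h2 := (hrow d le_rfl).2
      rw [show b0 + d + 1 = b + 1 by omega] at h2
      omega
    have hlam0 := hG.lam_anti 0 (R a b) (by omega)
    have hrL : R a b < L := (hL _).1 (by omega)
    obtain ⟨f1, rfl⟩ : ∃ f1, f = f1 + d := ⟨f - d, by omega⟩
    have hjrow : jdtAux (f1 + d) (mkT L (lamW w k) (TR R)) (R a b0) (R a b0 + b0 - a)
        = jdtAux f1 (mkT L (lamW w k) (TR R)) (R a b) (R a b + b - a) := by
      rw [jdt_row hG hT hq L hL a (R a b0) (R a b0 + b0 - a) d f1 hak (by omega), hc0, hRb]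
      intro t ht
      rw [show a + (R a b0 + b0 - a) + t - R a b0 = b0 + t by omega]
      exact hrow t ht
    rw [hjrow]
    -- the pipe
    have hU1 : Und g R k n a b 1 := ⟨hT, le_rfl, by omega, by omega, hblb, hnbd,
      fun t h1 h2 => by omega⟩
    have hS : hasS (g.tile (a+1) (b+2)) = true := by
      rcases hU1.base.2.2.2.2 with h | h <;> rw [h] <;> rfl
    have hN : hasN (g.tile (a+1+1) (b+2)) = true := by
      rw [← hM.s (a+1) (b+2) (by omega) (by omega) (by omega) (by omega)]; exact hS
    have hpipe : pipeFromS g (a+1) (b+2) = backAux g (2*n+2) (a+1+1) (b+2) true := by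
      unfold pipeFromS
      rw [hT.gn, if_neg (by omega)]
    rcases col_lemma hG hT hM hb (b+2) (by omega) (by omega) (k - (a+1)) (a+1) (2*n+2) (by omega)
      (by omega) (by omega) hN with ⟨x', hx1, hx2, hnw, hvert, q, hqlt, hback⟩ | ⟨hvert, hback⟩
    · -- not final
      obtain ⟨s, rfl⟩ : ∃ s, x' = a + s + 1 := ⟨x' - a - 1, by omega⟩
      have hU : Und g R k n a b s := ⟨hT, by omega, by omega, by omega, hblb, hnbd,
        fun t h1 h2 => hvert t h1 (by omega)⟩
      have hlow : Und.Low g k n a b s (a+s+1) := Or.inl ⟨by omega, rfl, hnw⟩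
      have hfind : (List.range' 1 g.n).find? (fun x =>
            decide (a+1 < x) && (g.tile x (b+1+1) == Tile.nw)) = some (a+s+1) := by
        apply find_first
        · omega
        · rw [hT.gn]; omega
        · rw [show b + 1 + 1 = b + 2 from rfl, hnw]
          simp; omega
        · intro y hy1 hy2
          rcases Nat.lt_or_ge (a+1) y with h | h
          · rw [show b + 1 + 1 = b + 2 from rfl, hvert y h hy2]; simp
          · simp; omega
      have hiter : nablaIter g (a+1) (a+s+1) (b+1) =
          ⟨g.n, nablaUndroop g.tile (a+1) (a+s+1) (b+1)⟩ := by
        apply nablaIter_eq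
        intro t h1 h2
        have := ((hU.vals (t-a) (by omega)).2.2 (by omega)).2
        rw [show a + (t-a) = t by omega] at this
        rw [this]; simp
      have hloop : nablaLoop g (F+1) (a+1, b0+1) =
          nablaLoop ⟨g.n, nablaUndroop g.tile (a+1) (a+s+1) (b+1)⟩ F (a+s+1, b+1+1) := by
        conv_lhs => unfold nablaLoop
        simp only [hslide]
        rw [show b + 1 + 1 = b + 2 from rfl] at *
        simp only [hpipe, hback]
        rw [if_neg (by omega)]
        simp only [hfind, hiter]
      rw [hloop]
      have hT' := hU.top' hlow
      obtain ⟨f2, rfl⟩ : ∃ f2, f1 = f2 + 1 + (s - 1) := ⟨f1 - 1 - (s - 1), by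
        have h1 := hU.vals s le_rfl
        have h2 := (cell_iff hG hT hq (R a b + (s-1)) (R a b + b - a)).2 (by
          have := hT.D_mono (R a b + (s-1)) (R a b + b - a) (a+s) k (by omega) le_rfl
          rw [show a + s + (R a b + b - a) - (R a b + (s-1)) = b + 1 by omega] at this
          omega)
        have h3 := (hL (R a b + (s-1))).1 (by omega)
        omega⟩
      rw [jdt_step hG hU hlow hq L hL f2]
      have hR' : RU R a b s (a+s) (b+1) = R a b + (s-1) := by
        rw [RU_in _ _ _ _ _ _ (by omega)]
        have h1 := hU.vals s le_rfl
        omega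
      have key := ih ⟨g.n, nablaUndroop g.tile (a+1) (a+s+1) (b+1)⟩ (RU R a b s) (a+s) (b+1) (f2+1)
        hT' ?_ ?_ (by omega) (by omega) ?_ (by omega) ?_
      · rw [hR', show R a b + (s-1) + (b+1) - (a+s) = R a b + b - a by omega] at key
        exact key
      · have hsame : ∀ x y, k < x → nablaUndroop g.tile (a+1) (a+s+1) (b+1) x y = g.tile x y := by
          intro x y hx
          unfold nablaUndroop
          rw [if_neg (by omega), if_neg (by omega), if_neg (by omega), if_neg (by omega),
            if_neg (by omega), if_neg (by omega)]
        refine ⟨?_, ?_, ?_, ?_, ?_⟩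
        · intro x y hx
          show _ → _ → _ → (hasN (nablaUndroop g.tile (a+1) (a+s+1) (b+1) x y) = true ↔ _)
          rw [hsame x y hx]; exact hb.N x y hx
        · intro x y hx
          show _ → _ → _ → (hasS (nablaUndroop g.tile (a+1) (a+s+1) (b+1) x y) = true ↔ _)
          rw [hsame x y hx]; exact hb.S x y hx
        · intro x y hx
          show _ → _ → _ → (hasE (nablaUndroop g.tile (a+1) (a+s+1) (b+1) x y) = true ↔ _)
          rw [hsame x y hx]; exact hb.E x y hx
        · intro x y hx
          show _ → _ → _ → (hasW (nablaUndroop g.tile (a+1) (a+s+1) (b+1) x y) = true ↔ _)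
          rw [hsame x y hx]; exact hb.W x y hx
        · intro x y hx
          show _ → _ → _ → (nablaUndroop g.tile (a+1) (a+s+1) (b+1) x y ≠ _ ∧
            nablaUndroop g.tile (a+1) (a+s+1) (b+1) x y ≠ _)
          rw [hsame x y hx]; exact hb.nb x y hx
      · intro r j hr
        rw [RU_out _ _ _ _ _ _ (by omega)]
        exact hq r j hr
      · show nablaUndroop g.tile (a+1) (a+s+1) (b+1) (a+s+1) (b+1+1) = Tile.blank
        have hs1 := hU.s1
        unfold nablaUndroop
        rw [if_neg (by omega), if_neg (by omega), if_neg (by omega), if_pos (by omega)]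
        rw [show b + 1 + 1 = b + 2 from rfl, hnw]
      · rw [hR']
        omega
    · -- final
      obtain ⟨s, hs⟩ : ∃ s, a + s = k := ⟨k - a, by omega⟩
      have hU : Und g R k n a b s := ⟨hT, by omega, by omega, by omega, hblb, hnbd,
        fun t h1 h2 => hvert t h1 (by omega)⟩
      have hx0 := fin_x0 hG hU hs hq
      have hw := fin_w hG hU hs hq
      obtain ⟨x0, hx0def⟩ : ∃ x0, x0 = w.symm (b+1) := ⟨_, rfl⟩
      rw [← hx0def] at hx0
      have hwx : w x0 = b + 1 := by rw [hx0def]; simp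
      have hsy : w.symm (b+2) = k - (R a b + (s-1)) := by
        rw [← hw.2]; simp
      have hlow : Und.Low g k n a b s x0 := Or.inr ⟨hs, hx0.1, hx0.2⟩
      have hcross : g.tile x0 (b+2) = Tile.cross := by
        apply tl_cross
        · exact (hb.nb x0 (b+2) hx0.1 hx0.2 (by omega) (by omega)).1
        · rw [hb.E x0 (b+2) hx0.1 hx0.2 (by omega) (by omega)]; omega
        · rw [hb.W x0 (b+2) hx0.1 hx0.2 (by omega) (by omega)]; omega
        · rw [hb.S x0 (b+2) hx0.1 hx0.2 (by omega) (by omega)]; omega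
      have hfind : (List.range' 1 g.n).find? (fun x =>
            decide (a+1 < x) && (g.tile x (b+1+1) == Tile.cross) &&
            (backAux g (2 * g.n + 2) x (b+1+1) false == some (b+1))) = some x0 := by
        rw [show b + 1 + 1 = b + 2 from rfl]
        apply find_first
        · omega
        · rw [hT.gn]; omega
        · rw [hcross, hT.gn, back_botE hM hb hG (2*n+2) x0 (b+2) hx0.1 hx0.2 (by omega) (by omega)
            (by omega) (by rw [hcross]; rfl), hwx]
          simp; omega
        · intro y hy1 hy2
          by_contra hh
          simp only [Bool.not_eq_false, Bool.and_eq_true, decide_eq_true_eq, beq_iff_eq] at hh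
          obtain ⟨⟨c1, c2⟩, c3⟩ := hh
          rcases Nat.lt_or_ge k y with h | h
          · rw [hT.gn, back_botE hM hb hG (2*n+2) y (b+2) h (by omega) (by omega) (by omega)
              (by omega) (by rw [c2]; rfl)] at c3
            have : w y = w x0 := by rw [hwx]; simpa using c3
            have := w.injective this
            omega
          · rw [hvert y c1 h] at c2
            simp at c2
      have hiter : nablaIter g (a+1) x0 (b+1) =
          ⟨g.n, nablaUndroop g.tile (a+1) x0 (b+1)⟩ := by
        apply nablaIter_eq
        intro t h1 h2 h3
        rcases Nat.lt_or_ge k t with h | h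
        · have := (hb.S t (b+1) h (by omega) (by omega) (by omega)).1 (by rw [h3]; rfl)
          omega
        · have := ((hU.vals (t-a) (by omega)).2.2 (by omega)).2
          rw [show a + (t-a) = t by omega, h3] at this
          simp at this
      have hloop : nablaLoop g (F+1) (a+1, b0+1) =
          (⟨g.n, nablaUndroop g.tile (a+1) x0 (b+1)⟩, b+1) := by
        conv_lhs => unfold nablaLoop
        simp only [hslide]
        rw [show b + 1 + 1 = b + 2 from rfl] at *
        simp only [hpipe, hback]
        rw [if_pos trivial]
        simp only [hfind, hiter]
      rw [hloop]
      refine ⟨RU R a b s, hU.top' hlow, fin_GP hG hU hs hq, fin_HQ hG hU hs hq, ?_⟩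
      intro L' hL'
      have hs1 := hU.s1
      obtain ⟨f2, rfl⟩ : ∃ f2, f1 = f2 + 1 + (s - 1) := ⟨f1 - 1 - (s - 1), by
        have h1 := hU.vals s le_rfl
        have h2 := (cell_iff hG hT hq (R a b + (s-1)) (R a b + b - a)).2 (by
          have := hT.D_mono (R a b + (s-1)) (R a b + b - a) (a+s) k (by omega) le_rfl
          rw [show a + s + (R a b + b - a) - (R a b + (s-1)) = b + 1 by omega] at this
          omega)
        have h3 := (hL (R a b + (s-1))).1 (by omega)
        omega⟩
      rw [jdt_step hG hU hlow hq L hL f2]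
      exact fin_jdt hG hU hs hq L hL _ f2 L' hL'



theorem lam_pos {w : Perm'} {k n : ℕ} (hG : GP w k n) (hd : w (k+1) < w k) : 0 < lamW w k 0 := by
  by_contra hh
  have hz : ∀ v, v ≤ k → w v = v := by
    intro v hv
    have h1 := hG.lam_anti 0 (k-v) (by omega)
    have h2 := hG.le v hv
    have h3 : lamW w k (k-v) = w v - v := by
      unfold lamW; rw [show k - (k-v) = v by omega]
    omega
  have h1 := hz k le_rfl
  have h2 := hz (w (k+1)) (by omega)
  have := w.injective h2
  omega

theorem no_blank {g : Grid} {R : ℕ → ℕ → ℕ} {k n : ℕ} (hT : Top g R k n) (m : ℕ) (hm : m ≤ k)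
    (hb : ∀ t y, t < m → y < n → g.tile (t+1) (y+1) ≠ Tile.blank) (y : ℕ) : R m y = m - y := by
  have hkn := hT.kn
  induction m generalizing y with
  | zero => rw [hT.R0]; omega
  | succ m ih =>
    rcases y with _ | y
    · rw [hT.Rc _ hm]; rfl
    · rcases Nat.lt_or_ge y n with h | h
      · have h1 := (hT.blank_iff m y (by omega) h).2.1 (hb m y (by omega) h)
        have h2 := ih (by omega) (fun t y ht hy => hb t y (by omega) hy) y
        omega
      · rw [hT.Rn _ _ hm (by omega)]; omega

theorem sum_ge (L : ℕ) (lam : ℕ → ℕ) (T : ℕ → ℕ → ℕ) (hL : 1 ≤ L) (hpos : ∀ r, r < L → 0 < lam r) :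
    lam 0 + L ≤ ((mkT L lam T).map List.length).sum + 1 := by
  unfold mkT
  induction L with
  | zero => omega
  | succ L ih =>
    rw [List.range_succ, List.map_append, List.map_append, List.sum_append]
    rcases Nat.eq_zero_or_pos L with h | h
    · subst h; simp
    · have h1 := ih h (fun r hr => hpos r (by omega))
      have h2 := hpos L (by omega)
      simp only [List.map_cons, List.map_nil, List.sum_cons, List.sum_nil, List.length_map,
        List.length_range]
      omega

theorem getLastD_mem' (l : List ℕ) (h : l ≠ []) : l.getLastD 0 ∈ l := by
  rw [List.getLastD_eq_getLast?, List.getLast?_eq_some_getLast h]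
  exact List.getLast_mem h

theorem main (w : Perm') (k n L : ℕ) (hG : GP w k n) (hL : ∀ r, 0 < lamW w k r ↔ r < L)
    (g : Grid) (R : ℕ → ℕ → ℕ) (hT : Top g R k n) (hb : Bot g w k n) (hq : HQ R w k)
    (hp : 0 < lamW w k 0) :
    ∃ R', Top (nabla g) R' k n ∧ GP (sT (pop g).2 * w) k n ∧ HQ R' (sT (pop g).2 * w) k ∧
      ∀ L', (∀ r, 0 < lamW (sT (pop g).2 * w) k r ↔ r < L') →
        jdt (mkT L (lamW w k) (TR R)) = mkT L' (lamW (sT (pop g).2 * w) k) (TR R') := by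
  classical
  have hkn := hG.kn
  have hL1 : 0 < L := (hL 0).1 hp
  have ex : ∃ a, a < k ∧ ∃ y, y < n ∧ g.tile (a+1) (y+1) = Tile.blank := by
    by_contra hh
    push Not at hh
    have h1 := no_blank hT k le_rfl (fun t y ht hy => hh t ht y hy) k
    have h2 := (cell_iff hG hT hq 0 0).1 hp
    simp at h2
    omega
  obtain ⟨a, hadef⟩ : ∃ a, a = Nat.find ex := ⟨_, rfl⟩
  have hspec := Nat.find_spec ex
  rw [← hadef] at hspec
  obtain ⟨hak, y0, hy0, hbl0⟩ := hspec
  have hmin : ∀ t y, t < a → y < n → g.tile (t+1) (y+1) ≠ Tile.blank := by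
    intro t y ht hy hbl
    rw [hadef] at ht
    exact Nat.find_min ex ht ⟨by omega, y, hy, hbl⟩
  have hRa := no_blank hT a hak.le hmin
  have hfind : (List.range' 1 g.n).find?
      (fun i => (List.range' 1 g.n).any (fun j => g.tile i j == Tile.blank)) = some (a+1) := by
    rw [hT.gn]
    apply find_first
    · omega
    · omega
    · rw [List.any_eq_true]
      refine ⟨y0+1, ?_, ?_⟩
      · rw [List.mem_range'_1]; omega
      · simp [hbl0]
    · intro t h1 h2
      rw [List.any_eq_false]
      intro y hy
      rw [List.mem_range'_1] at hy
      have := hmin (t-1) (y-1) (by omega) (by omega)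
      rw [show t - 1 + 1 = t by omega, show y - 1 + 1 = y by omega] at this
      simpa using this
  have hmem := getLastD_mem' ((List.range' 1 g.n).filter (fun j => g.tile (a+1) j == Tile.blank))
    (by
      apply List.ne_nil_of_mem (a := y0+1)
      rw [List.mem_filter, List.mem_range'_1, hT.gn]
      exact ⟨by omega, by simp [hbl0]⟩)
  rw [List.mem_filter, List.mem_range'_1, hT.gn] at hmem
  have hnp : nablaPop g = ((nablaLoop g (g.n+1) (a+1, ((List.range' 1 g.n).filter
      (fun j => g.tile (a+1) j == Tile.blank)).getLastD 0)).1, a+1,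
      (nablaLoop g (g.n+1) (a+1, ((List.range' 1 g.n).filter
      (fun j => g.tile (a+1) j == Tile.blank)).getLastD 0)).2) := by
    unfold nablaPop
    simp only [hfind]
  rw [hT.gn] at hnp
  generalize ((List.range' 1 n).filter (fun j => g.tile (a+1) j == Tile.blank)).getLastD 0 = j0
    at hmem hnp
  obtain ⟨⟨hj1, hj2⟩, hj3⟩ := hmem
  obtain ⟨b0, rfl⟩ : ∃ b0, j0 = b0 + 1 := ⟨j0 - 1, by omega⟩
  have hbl : g.tile (a+1) (b0+1) = Tile.blank := by simpa using hj3
  have hab : a ≤ b0 := by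
    have e := hT.eN a b0 hak (by omega)
    rw [hbl, hRa, hRa] at e
    simp [hasN] at e
    omega
  have hR0 : R a b0 = 0 := by rw [hRa]; omega
  have hsum := sum_ge L (lamW w k) (TR R) hL1 (fun r hr => (hL r).2 hr)
  have hRb : R (a+1) (b0+1) = 1 := by
    have := (hT.blank_iff a b0 hak (by omega)).1.1 hbl
    omega
  have hmono : ∀ e y, y + e = b0 + 1 → 1 ≤ R (a+1) y := by
    intro e
    induction e with
    | zero => intro y hy; rw [show y = b0 + 1 by omega]; omega
    | succ e ih =>
      intro y hy
      have h1 := ih (y+1) (by omega)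
      have h2 := hT.right (a+1) y (by omega)
      omega
  have hv : ∀ t, t ≤ b0 - a → R a (a + 0 + t - 0) = 0 ∧ R (a+1) (a + 0 + t - 0 + 1) = 0 + 1 := by
    intro t ht
    have h1 := hRa (a + 0 + t - 0)
    have h2 := hmono (b0 - (a + t)) (a + 0 + t - 0 + 1) (by omega)
    have h3 := hT.diag a (a + 0 + t - 0) hak
    omega
  have hcell : b0 - a < lamW w k 0 := by
    rw [cell_iff hG hT hq]
    have h1 := hT.D_mono 0 (b0-a) (a+1) k (by omega) le_rfl
    rw [show a + 1 + (b0 - a) - 0 = b0 + 1 by omega] at h1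
    omega
  obtain ⟨f, hf⟩ : ∃ f, ((mkT L (lamW w k) (TR R)).map List.length).sum + 1 = f + (b0 - a) :=
    ⟨((mkT L (lamW w k) (TR R)).map List.length).sum + 1 - (b0 - a), by omega⟩
  have key := loop w k n L hG hL (n+1) g R a b0 f hT hb hq hak (by omega) hbl (by omega) (by omega)
  unfold nabla pop jdt
  rw [hnp, hf, jdt_row hG hT hq L hL a 0 0 (b0-a) f hak (by omega) hv]
  rw [hR0, show 0 + b0 - a = 0 + (b0 - a) by omega] at key
  exact key

theorem stmt6_aux (w : Perm') (hG : Grassmannian w) (hl : 1 ≤ plen w)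
    (B : Grid) (hB : MemBPD w B) :
    jdt (weigandt B (shapeOf w B.n))
      = weigandt (nabla B) (shapeOf (sT (pop B).2 * w) (nabla B).n) := by
  obtain ⟨k, hGP, hdes⟩ := gp_of w B.n hG hl hB.2.2.1
  have hT := top_of B w k B.n hB rfl hGP
  have hb := bot_of B w k B.n hB rfl hGP
  have hq := hq_of B w k B.n hB rfl hGP
  obtain ⟨L, hLk, hL⟩ := hGP.exL
  obtain ⟨R', hT', hG', hq', hj⟩ := main w k B.n L hGP hL B _ hT hb hq (lam_pos hGP hdes)
  obtain ⟨L', hLk', hL'⟩ := hG'.exL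
  rw [hT'.gn, hGP.shape L hLk (fun r _ => hL r), hG'.shape L' hLk' (fun r _ => hL' r),
    hT.weig L _ (fun r c _ h => (cell_iff hGP hT hq r c).1 h),
    hT'.weig L' _ (fun r c _ h => (cell_iff hG' hT' hq' r c).1 h)]
  exact hj L' hL'


/-- For `w` Grassmannian with `ℓ(w) ≥ 1` and `B ∈ BPD(w)`:
`jdt(γ(B)) = γ(∇B)`, where `∇B ∈ BPD(s_a w)` for `pop(B) = (r, a)`. -/
theorem stmt6 (w : Perm') (hG : Grassmannian w) (hl : 1 ≤ plen w)
    (B : Grid) (hB : MemBPD w B) :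
    jdt (weigandt B (shapeOf w B.n))
      = weigandt (nabla B) (shapeOf (sT (pop B).2 * w) (nabla B).n) := by
  exact stmt6_aux w hG hl B hB

end BPDPaper
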